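/- arXiv:1911.05995 — 4 statements merged into one kernel-verified Lean document; each statement's English description precedes it below -/
import Mathlib

section
/- Let n = m·l with m, l ≥ 1, let ξ ∈ ℂ be a primitive n-th root of unity, and let σ, τ_n^b(ξ) be as in the context. Suppose b = (b_1,…,b_m) ∈ (ℂ^×)^m satisfies: whenever b_i·b_j⁻¹ = ξ^{rm} for some integer r, then b_i = b_j. Let C denote the centralizer of τ_n^b(ξ) in GL_n(ℂ). Then for A ∈ C, there exists B ∈ C with A = σ^{−m}·B·σ^{m}·B⁻¹ if and only if the ordered product (σ^{−(l−1)m}·A·σ^{(l−1)m})·(σ^{−(l−2)m}·A·σ^{(l−2)m})⋯(σ^{−m}·A·σ^{m})·A equals I_n. -/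
/-- The permutation matrix of the `n`-cycle `(1 2 ⋯ n)`, i.e. `σ · e_j = e_{j+1}`
with indices taken modulo `n`. -/
noncomputable def cycleMatrix (n : ℕ) : Matrix (Fin n) (Fin n) ℂ :=
  Matrix.of fun i j => if (i : ℕ) = ((j : ℕ) + 1) % n then 1 else 0

/-- The diagonal of the matrix `τ_n^b(ξ)`: the entry at position `i = j·m + i₀`
(`0 ≤ j ≤ l−1`, `0 ≤ i₀ ≤ m−1`) is `ξ^{jm}·b_{i₀}`. -/
noncomputable def tauDiag (l m : ℕ) (ξ : ℂ) (b : Fin m → ℂˣ) : Fin (l * m) → ℂ :=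
  fun i => ξ ^ (m * (i.divNat : ℕ)) * (b i.modNat : ℂ)

/-- The diagonal matrix
`τ_n^b(ξ) = diag(b_1, …, b_m, ξ^m b_1, …, ξ^m b_m, …, ξ^{(l−1)m} b_1, …, ξ^{(l−1)m} b_m)`,
where `n = l·m`. -/
noncomputable def tauMatrix (l m : ℕ) (ξ : ℂ) (b : Fin m → ℂˣ) :
    Matrix (Fin (l * m)) (Fin (l * m)) ℂ :=
  Matrix.diagonal (tauDiag l m ξ b)

section TwistedProducts

variable {R : Type*} [Ring R]

/-- The ordered product `φ^{k-1}(a) ⋯ φ(a) · a`. -/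
def twistedProd (φ : R →+* R) (a : R) (k : ℕ) : R :=
  ((List.range k).map fun j => φ^[k - 1 - j] a).prod

theorem twistedProd_zero (φ : R →+* R) (a : R) : twistedProd φ a 0 = 1 := by
  simp [twistedProd]

theorem twistedProd_succ (φ : R →+* R) (a : R) (k : ℕ) :
    twistedProd φ a (k + 1) = φ (twistedProd φ a k) * a := by
  simp only [twistedProd, List.range_succ, List.map_append, List.prod_append, map_list_prod,
    List.map_map, List.map_cons, List.map_nil, List.prod_singleton]
  congr 1
  · congr 1
    refine List.map_congr_left fun j hj => ?_
    have hjk : j < k := List.mem_range.mp hj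
    rw [Function.comp_apply, ← Function.iterate_succ_apply' (f := φ)]
    congr 1
    omega
  · simp

theorem twistedProd_mul_of_map_eq (φ : R →+* R) {a x : R} (h : φ x = a * x) (k : ℕ) :
    twistedProd φ a k * x = φ^[k] x := by
  induction k with
  | zero => simp [twistedProd_zero]
  | succ k ih =>
    rw [twistedProd_succ, mul_assoc, ← h, ← map_mul, ih, Function.iterate_succ_apply']

theorem isUnit_twistedProd (φ : R →+* R) {a : R} (ha : IsUnit a) (k : ℕ) :
    IsUnit (twistedProd φ a k) := by
  induction k with
  | zero => simp [twistedProd_zero]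
  | succ k ih => rw [twistedProd_succ]; exact (ih.map φ).mul ha

theorem commute_twistedProd (φ : R →+* R) {a t : R} (ha : Commute a t)
    (hφ : ∀ x, Commute x t → Commute (φ x) t) (k : ℕ) : Commute (twistedProd φ a k) t := by
  induction k with
  | zero => rw [twistedProd_zero]; exact Commute.one_left t
  | succ k ih => rw [twistedProd_succ]; exact (hφ _ ih).mul_left ha

/-- A multiplicative Hilbert 90 for the centralizer of `t`, when `φ` permutes cyclically a complete
family of orthogonal idempotents that are central in that centralizer. -/
theorem exists_isUnit_map_eq_mul (φ : R →+* R) {t a : R} {l : ℕ}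
    (hφ : ∀ x, Commute x t → Commute (φ x) t) (P : ℕ → R) (hPt : ∀ j, Commute (P j) t)
    (hP : ∀ x, Commute x t → ∀ j, Commute x (P j)) (hφP : ∀ j, φ (P j) = P (j + 1))
    (hPl : P l = P 0) (horth : ∀ j < l, ∀ k < l, P j * P k = if j = k then P j else 0)
    (hsum : ∑ j ∈ Finset.range l, P j = 1) (ha : IsUnit a) (hat : Commute a t)
    (hprod : twistedProd φ a l = 1) :
    ∃ x, IsUnit x ∧ Commute x t ∧ φ x = a * x := by
  choose N hN using isUnit_twistedProd φ ha
  have hNt (j : ℕ) : Commute (N j : R) t := hN j ▸ commute_twistedProd φ hat hφ j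
  have hNt' (j : ℕ) : Commute ((N j)⁻¹ : Rˣ).val t := (hNt j).units_inv_left
  have key (f g : ℕ → R) (hg : ∀ j, Commute (g j) t) (hfg : ∀ j, f j * g j = 1) :
      (∑ j ∈ Finset.range l, f j * P j) * ∑ j ∈ Finset.range l, g j * P j = 1 := by
    rw [Finset.sum_mul_sum, ← hsum]
    refine Finset.sum_congr rfl fun j hj => ?_
    have hjk (k : ℕ) (hk : k ∈ Finset.range l) :
        f j * P j * (g k * P k) = if j = k then P j else 0 := by
      rw [mul_assoc, ← mul_assoc (P j), ← (hP _ (hg k) j).eq, mul_assoc (g k),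
        horth j (Finset.mem_range.mp hj) k (Finset.mem_range.mp hk)]
      split_ifs with h
      · rw [← h, ← mul_assoc, hfg, one_mul]
      · simp
    rw [Finset.sum_congr rfl hjk, Finset.sum_ite_eq, if_pos hj]
  refine ⟨∑ j ∈ Finset.range l, ((N j)⁻¹ : Rˣ).val * P j, ?_, ?_, ?_⟩
  · exact isUnit_iff_exists.mpr ⟨_, key _ (fun j => N j) hNt fun j => by simp,
      key _ _ hNt' fun j => by simp⟩
  · exact Commute.sum_left _ _ _ fun j _ => (hNt' j).mul_left (hPt j)
  · have hstep (j : ℕ) :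
        φ (((N j)⁻¹ : Rˣ).val * P j) = a * (((N (j + 1))⁻¹ : Rˣ).val * P (j + 1)) := by
      have hu : φ ((N j)⁻¹ : Rˣ).val * φ (N j : R) = 1 := by rw [← map_mul]; simp
      have hs : (N (j + 1) : R) = φ (N j) * a := by rw [hN, hN, twistedProd_succ]
      rw [map_mul, hφP, ← mul_assoc]
      congr 1
      rw [← Units.mul_inv_eq_iff_eq_mul, inv_inv, hs, ← mul_assoc, hu, one_mul]
    have h0 : N 0 = 1 := Units.ext (by rw [hN, twistedProd_zero]; rfl)
    have hl : N l = 1 := Units.ext (by rw [hN, hprod]; rfl)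
    rw [map_sum, Finset.sum_congr rfl fun j _ => hstep j, ← Finset.mul_sum]
    congr 1
    have := Finset.sum_range_succ' (fun j => ((N j)⁻¹ : Rˣ).val * P j) l
    rw [Finset.sum_range_succ, h0, hl, hPl] at this
    exact (add_right_cancel this).symm

/-- Conjugation `x ↦ u⁻¹ x u` as a ring homomorphism. -/
def unitConj (u : Rˣ) : R →+* R :=
  MulSemiringAction.toRingHom (ConjAct Rˣ) R (ConjAct.toConjAct u⁻¹)

theorem unitConj_apply (u : Rˣ) (x : R) : unitConj u x = (u⁻¹ : Rˣ).val * x * u := by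
  simp [unitConj, ConjAct.units_smul_def]

theorem unitConj_iterate (u : Rˣ) (k : ℕ) (x : R) :
    (unitConj u)^[k] x = ((u ^ k)⁻¹ : Rˣ).val * x * (u ^ k : Rˣ).val := by
  induction k with
  | zero => simp
  | succ k ih =>
    rw [Function.iterate_succ_apply', ih, unitConj_apply, pow_succ, mul_inv_rev]
    simp only [Units.val_mul, mul_assoc]

end TwistedProducts

section CycleMatrix

theorem cycleMatrix_pow_apply {n : ℕ} (k : ℕ) (i j : Fin n) :
    (cycleMatrix n ^ k) i j = if (i : ℕ) = ((j : ℕ) + k) % n then 1 else 0 := by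
  induction k generalizing j with
  | zero => simp [Matrix.one_apply, Nat.mod_eq_of_lt j.isLt, Fin.ext_iff]
  | succ k ih =>
    have hn : 0 < n := i.pos
    rw [pow_succ, Matrix.mul_apply,
      Finset.sum_eq_single (⟨((j : ℕ) + 1) % n, Nat.mod_lt _ hn⟩ : Fin n)]
    · rw [ih]
      simp [cycleMatrix, add_assoc, add_comm 1 k]
    · intro c _ hc
      have : (c : ℕ) ≠ ((j : ℕ) + 1) % n := fun h => hc (Fin.ext h)
      simp [cycleMatrix, this]
    · simp

theorem cycleMatrix_pow_self (n : ℕ) : cycleMatrix n ^ n = 1 := by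
  ext i j
  rw [cycleMatrix_pow_apply, Nat.add_mod_right, Nat.mod_eq_of_lt j.isLt]
  simp [Matrix.one_apply, Fin.ext_iff]

theorem diagonal_mul_cycleMatrix_pow {n : ℕ} (k : ℕ) (d : Fin n → ℂ) (d' : Fin n → ℂ)
    (h : ∀ i j : Fin n, (i : ℕ) = ((j : ℕ) + k) % n → d i = d' j) :
    Matrix.diagonal d * cycleMatrix n ^ k = cycleMatrix n ^ k * Matrix.diagonal d' := by
  ext i j
  rw [Matrix.diagonal_mul, Matrix.mul_diagonal, cycleMatrix_pow_apply]
  split_ifs with hij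
  · rw [h i j hij, mul_comm]
  · simp

end CycleMatrix

section Blocks

variable {l m : ℕ}

/-- The diagonal idempotents of the blocks of size `m`: the `j`-th one selects the block with
index congruent to `-j` modulo `l`. -/
noncomputable def blockIdempotent (l m j : ℕ) : Matrix (Fin (l * m)) (Fin (l * m)) ℂ :=
  Matrix.diagonal fun i => if ((i.divNat : ℕ) + j) % l = 0 then 1 else 0

theorem divNat_of_eq_add_mod {i j : Fin (l * m)} (h : (i : ℕ) = ((j : ℕ) + m) % (l * m)) :
    (i.divNat : ℕ) = ((j.divNat : ℕ) + 1) % l := by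
  have hm : 0 < m := Nat.pos_of_ne_zero fun h0 => by subst h0; exact absurd j.pos (by simp)
  rw [Fin.coe_divNat, Fin.coe_divNat, h, Nat.mod_mul_left_div_self, Nat.add_div_right _ hm]

theorem modNat_of_eq_add_mod {i j : Fin (l * m)} (h : (i : ℕ) = ((j : ℕ) + m) % (l * m)) :
    i.modNat = j.modNat := by
  apply Fin.ext
  rw [Fin.coe_modNat, Fin.coe_modNat, h, Nat.mod_mul_left_mod, Nat.add_mod_right]

theorem blockIdempotent_mul_cycleMatrix_pow (j : ℕ) :
    blockIdempotent l m j * cycleMatrix (l * m) ^ m =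
      cycleMatrix (l * m) ^ m * blockIdempotent l m (j + 1) := by
  refine diagonal_mul_cycleMatrix_pow m _ _ fun i k h => ?_
  rw [divNat_of_eq_add_mod h, Nat.mod_add_mod, add_assoc, add_comm 1 j]

theorem tauMatrix_mul_cycleMatrix_pow {ξ : ℂ} (hξ : ξ ^ (l * m) = 1) (b : Fin m → ℂˣ) :
    tauMatrix l m ξ b * cycleMatrix (l * m) ^ m =
      cycleMatrix (l * m) ^ m * (ξ ^ m • tauMatrix l m ξ b) := by
  have hξ' : (ξ ^ m) ^ l = 1 := by rw [← pow_mul, mul_comm, hξ]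
  rw [tauMatrix, ← Matrix.diagonal_smul]
  refine diagonal_mul_cycleMatrix_pow m _ _ fun i k h => ?_
  rw [tauDiag, divNat_of_eq_add_mod h, modNat_of_eq_add_mod h, pow_mul, ← pow_eq_pow_mod _ hξ',
    Pi.smul_apply, tauDiag, pow_mul, pow_succ', smul_eq_mul, mul_assoc]

theorem blockIdempotent_self : blockIdempotent l m l = blockIdempotent l m 0 := by
  simp [blockIdempotent]

theorem blockIdempotent_mul {j k : ℕ} (hj : j < l) (hk : k < l) :
    blockIdempotent l m j * blockIdempotent l m k =
      if j = k then blockIdempotent l m j else 0 := by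
  rw [blockIdempotent, blockIdempotent, Matrix.diagonal_mul_diagonal]
  split_ifs with h
  · subst h
    congr 1
    ext i
    split_ifs <;> simp
  · rw [← Matrix.diagonal_zero]
    congr 1
    ext i
    split_ifs with h1 h2
    · have h3 : (i.divNat : ℕ) + j ≡ (i.divNat : ℕ) + k [MOD l] := h1.trans h2.symm
      exact absurd ((Nat.ModEq.add_left_cancel' _ h3).eq_of_lt_of_lt hj hk) h
    all_goals simp

theorem sum_blockIdempotent :
    ∑ j ∈ Finset.range l, blockIdempotent l m j = 1 := by
  ext i k
  rw [Matrix.sum_apply, Matrix.one_apply]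
  by_cases hik : i = k
  · subst hik
    have hd : (i.divNat : ℕ) < l := i.divNat.isLt
    simp only [blockIdempotent, Matrix.diagonal_apply_eq, if_true]
    rw [Finset.sum_eq_single ((l - i.divNat) % l)]
    · rw [if_pos]
      rw [Nat.add_mod_mod, Nat.add_sub_cancel' hd.le, Nat.mod_self]
    · intro c hc hne
      rw [if_neg]
      intro h
      apply hne
      have h1 : (i.divNat : ℕ) + c ≡ (i.divNat : ℕ) + (l - i.divNat) [MOD l] := by
        rw [Nat.add_sub_cancel' hd.le]
        exact h.trans (Nat.mod_self l).symm
      have h2 := Nat.ModEq.add_left_cancel' _ h1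
      rw [← h2, Nat.mod_eq_of_lt (Finset.mem_range.mp hc)]
    · intro h
      exact absurd (Finset.mem_range.mpr (Nat.mod_lt _ (by omega))) h
  · simp [blockIdempotent, hik]

theorem divNat_eq_of_tauDiag_eq {ξ : ℂ} (hξ : IsPrimitiveRoot ξ (l * m)) {b : Fin m → ℂˣ}
    (hb : ∀ i j : Fin m, ∀ r : ℤ, (b i : ℂ) * ((b j : ℂ))⁻¹ = ξ ^ (r * (m : ℤ)) → b i = b j)
    {i k : Fin (l * m)} (h : tauDiag l m ξ b i = tauDiag l m ξ b k) : i.divNat = k.divNat := by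
  have hn : l * m ≠ 0 := i.pos.ne'
  have hξ0 : ξ ≠ 0 := hξ.ne_zero hn
  have hm : 0 < m := Nat.pos_of_ne_zero (right_ne_zero_of_mul hn)
  simp only [tauDiag] at h
  have hbik : b i.modNat = b k.modNat := by
    refine hb _ _ ((k.divNat : ℕ) - (i.divNat : ℕ) : ℤ) ?_
    have e : ((k.divNat : ℕ) - (i.divNat : ℕ) : ℤ) * (m : ℤ) =
        ((m * (k.divNat : ℕ) : ℕ) : ℤ) - ((m * (i.divNat : ℕ) : ℕ) : ℤ) := by
      push_cast; ring
    rw [e, zpow_sub₀ hξ0, zpow_natCast, zpow_natCast]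
    have := (b k.modNat).ne_zero
    field_simp
    linear_combination h
  rw [hbik] at h
  have hpow := mul_right_cancel₀ (b k.modNat).ne_zero h
  have hlt (x : Fin (l * m)) : m * (x.divNat : ℕ) < l * m := by
    rw [mul_comm]; exact Nat.mul_lt_mul_of_pos_right x.divNat.isLt hm
  exact Fin.ext (Nat.eq_of_mul_eq_mul_left hm (hξ.pow_inj (hlt i) (hlt k) hpow))

theorem commute_blockIdempotent {ξ : ℂ} (hξ : IsPrimitiveRoot ξ (l * m)) {b : Fin m → ℂˣ}
    (hb : ∀ i j : Fin m, ∀ r : ℤ, (b i : ℂ) * ((b j : ℂ))⁻¹ = ξ ^ (r * (m : ℤ)) → b i = b j)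
    {X : Matrix (Fin (l * m)) (Fin (l * m)) ℂ} (hX : Commute X (tauMatrix l m ξ b)) (j : ℕ) :
    Commute X (blockIdempotent l m j) := by
  ext i k
  have h := congrFun (congrFun hX.eq i) k
  rw [tauMatrix, Matrix.mul_diagonal, Matrix.diagonal_mul, mul_comm] at h
  rw [blockIdempotent, Matrix.mul_diagonal, Matrix.diagonal_mul, mul_comm]
  by_cases hik : X i k = 0
  · simp [hik]
  · rw [divNat_eq_of_tauDiag_eq hξ hb (mul_right_cancel₀ hik h)]

end Blocks

/-- **Description of the commutators `[σ^{−m}, C(τ_n^b(ξ))]`.**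
Let `n = m·l`, `ξ` a primitive `n`-th root of unity, and suppose `b ∈ (ℂˣ)^m` satisfies:
`b_i·b_j⁻¹ = ξ^{rm}` for some integer `r` implies `b_i = b_j`.  For `A` in the centralizer
`C` of `τ_n^b(ξ)` in `GL_n(ℂ)`, there is `B ∈ C` with `A = σ^{−m}·B·σ^m·B⁻¹` if and only
if the ordered product
`(σ^{−(l−1)m}·A·σ^{(l−1)m})·(σ^{−(l−2)m}·A·σ^{(l−2)m})⋯(σ^{−m}·A·σ^m)·A` equals `I_n`. -/
theorem mem_commutator_coset_iff (m l : ℕ) (hm : 1 ≤ m) (hl : 1 ≤ l)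
    (ξ : ℂ) (hξ : IsPrimitiveRoot ξ (l * m)) (b : Fin m → ℂˣ)
    (hb : ∀ i j : Fin m, ∀ r : ℤ, (b i : ℂ) * ((b j : ℂ))⁻¹ = ξ ^ (r * (m : ℤ)) → b i = b j)
    (A : Matrix (Fin (l * m)) (Fin (l * m)) ℂ) (hA : IsUnit A)
    (hAc : Commute A (tauMatrix l m ξ b)) :
    (∃ B : Matrix (Fin (l * m)) (Fin (l * m)) ℂ, IsUnit B ∧ Commute B (tauMatrix l m ξ b) ∧
        A = (cycleMatrix (l * m))⁻¹ ^ m * B * cycleMatrix (l * m) ^ m * B⁻¹) ↔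
      ((List.range l).map (fun j =>
          (cycleMatrix (l * m))⁻¹ ^ ((l - 1 - j) * m) * A *
            cycleMatrix (l * m) ^ ((l - 1 - j) * m))).prod = 1 := by
  have hn : l * m ≠ 0 := by positivity
  have hξ0 : ξ ≠ 0 := hξ.ne_zero hn
  set t := tauMatrix l m ξ b
  have hσ : IsUnit (cycleMatrix (l * m)) := IsUnit.of_pow_eq_one (cycleMatrix_pow_self _) hn
  obtain ⟨s, hs⟩ := hσ
  have hinv : (cycleMatrix (l * m))⁻¹ = (s⁻¹ : (Matrix (Fin (l * m)) (Fin (l * m)) ℂ)ˣ).val := by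
    rw [← hs, Matrix.coe_units_inv]
  have hsn : s ^ (l * m) = 1 := Units.ext (by simp [hs, cycleMatrix_pow_self])
  have hconj {x y : Matrix (Fin (l * m)) (Fin (l * m)) ℂ}
      (h : x * cycleMatrix (l * m) ^ m = cycleMatrix (l * m) ^ m * y) :
      unitConj (s ^ m) x = y := by
    rw [unitConj_apply, mul_assoc, Units.val_pow_eq_pow_val, hs, h, ← hs,
      ← Units.val_pow_eq_pow_val, Units.inv_mul_cancel_left]
  have hiter (k : ℕ) (x : Matrix (Fin (l * m)) (Fin (l * m)) ℂ) :
      (unitConj (s ^ m))^[k] x =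
        (cycleMatrix (l * m))⁻¹ ^ (k * m) * x * cycleMatrix (l * m) ^ (k * m) := by
    rw [unitConj_iterate, ← pow_mul, mul_comm m k, ← inv_pow, Units.val_pow_eq_pow_val,
      Units.val_pow_eq_pow_val, hinv, hs]
  have hprod : ((List.range l).map (fun j =>
      (cycleMatrix (l * m))⁻¹ ^ ((l - 1 - j) * m) * A *
        cycleMatrix (l * m) ^ ((l - 1 - j) * m))).prod = twistedProd (unitConj (s ^ m)) A l := by
    simp only [twistedProd, hiter]
  have hφ1 (x : Matrix (Fin (l * m)) (Fin (l * m)) ℂ) :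
      unitConj (s ^ m) x = (cycleMatrix (l * m))⁻¹ ^ m * x * cycleMatrix (l * m) ^ m := by
    simpa using hiter 1 x
  have hφl (x : Matrix (Fin (l * m)) (Fin (l * m)) ℂ) : (unitConj (s ^ m))^[l] x = x := by
    rw [unitConj_iterate, ← pow_mul, mul_comm m l, hsn]
    simp
  rw [hprod]
  constructor
  · rintro ⟨B, hB, -, hAB⟩
    have hdet : IsUnit B.det := (Matrix.isUnit_iff_isUnit_det B).mp hB
    have hφB : unitConj (s ^ m) B = A * B := by
      rw [hφ1, hAB, Matrix.nonsing_inv_mul_cancel_right _ _ hdet]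
    have h := twistedProd_mul_of_map_eq _ hφB l
    rw [hφl] at h
    exact hB.mul_right_cancel (h.trans (one_mul B).symm)
  · intro hA1
    have hφt (x : Matrix (Fin (l * m)) (Fin (l * m)) ℂ) (hx : Commute x t) :
        Commute (unitConj (s ^ m) x) t := by
      have h := hx.map (unitConj (s ^ m))
      rw [hconj (tauMatrix_mul_cycleMatrix_pow hξ.pow_eq_one b)] at h
      exact (Commute.smul_right_iff₀ (pow_ne_zero m hξ0)).mp h
    obtain ⟨B, hB, hBt, hφB⟩ := exists_isUnit_map_eq_mul (unitConj (s ^ m)) hφt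
      (blockIdempotent l m) (fun j => Matrix.commute_diagonal _ _)
      (fun x hx j => commute_blockIdempotent hξ hb hx j)
      (fun j => hconj (blockIdempotent_mul_cycleMatrix_pow j)) blockIdempotent_self
      (fun j hj k hk => blockIdempotent_mul hj hk) sum_blockIdempotent hA hAc hA1
    have hdet : IsUnit B.det := (Matrix.isUnit_iff_isUnit_det B).mp hB
    refine ⟨B, hB, hBt, ?_⟩
    rw [← hφ1, hφB, Matrix.mul_nonsing_inv_cancel_right _ _ hdet]
end

section
/- Let n = m·l with m, l ≥ 1, let ξ ∈ ℂ be a primitive n-th root of unity, and let σ, τ_n^b(ξ) be as in the context. Suppose the n diagonal entries ξ^{jm}·b_i (1 ≤ i ≤ m, 0 ≤ j ≤ l−1) of τ_n^b(ξ) are pairwise distinct. Then a matrix A ∈ M_n(ℂ) commutes with both σ^m and τ_n^b(ξ) if and only if A is diagonal and its diagonal entries satisfy A_{ii} = A_{jj} whenever i ≡ j (mod m). Consequently, the stabilizer of the pair (σ^m, τ_n^b(ξ)) under simultaneous conjugation by GL_n(ℂ) is isomorphic to (ℂ^×)^m. -/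
theorem isUnit_cycleMatrix {n : ℕ} (hn : n ≠ 0) : IsUnit (cycleMatrix n) :=
  IsUnit.of_pow_eq_one (cycleMatrix_pow_self n) hn

theorem isUnit_tauMatrix {l m : ℕ} {ξ : ℂ} (hξ : ξ ≠ 0) (b : Fin m → ℂˣ) :
    IsUnit (tauMatrix l m ξ b) := by
  rw [tauMatrix, Matrix.isUnit_diagonal, Pi.isUnit_iff]
  intro i
  exact ((isUnit_iff_ne_zero.2 hξ).pow _).mul (b i.modNat).isUnit

theorem Matrix.commute_diagonal_iff_isDiag {n R : Type*} [Fintype n] [DecidableEq n]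
    [CommRing R] [IsDomain R] {d : n → R} (hd : Function.Injective d) {A : Matrix n n R} :
    Commute A (Matrix.diagonal d) ↔ A.IsDiag := by
  constructor
  · intro h i j hij
    have hA := congrFun (congrFun h.eq i) j
    rw [Matrix.mul_diagonal, Matrix.diagonal_mul, mul_comm] at hA
    by_contra h0
    exact hij (hd (mul_right_cancel₀ h0 hA)).symm
  · intro h
    rw [← h.diagonal_diag]
    exact Matrix.commute_diagonal _ _

theorem commute_diagonal_cycleMatrix_pow_iff {n : ℕ} (k : ℕ) (a : Fin n → ℂ) :
    Commute (Matrix.diagonal a) (cycleMatrix n ^ k) ↔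
      ∀ i j : Fin n, (i : ℕ) = ((j : ℕ) + k) % n → a i = a j := by
  rw [commute_iff_eq, ← Matrix.ext_iff]
  refine forall₂_congr fun i j => ?_
  rw [Matrix.mul_diagonal, Matrix.diagonal_mul, cycleMatrix_pow_apply]
  split_ifs with h <;> simp [h]

theorem forall_eq_add_mod_iff_forall_mod_eq {m n : ℕ} (hmn : m ∣ n) {α : Type*}
    (a : Fin n → α) :
    (∀ i j : Fin n, (i : ℕ) = ((j : ℕ) + m) % n → a i = a j) ↔
      ∀ i j : Fin n, (i : ℕ) % m = (j : ℕ) % m → a i = a j := by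
  constructor
  · intro h
    have key : ∀ (q r : ℕ) (hr : r < n) (hq : r + m * q < n), a ⟨r + m * q, hq⟩ = a ⟨r, hr⟩ := by
      intro q r hr
      induction q with
      | zero => intro _; simp
      | succ q ih =>
        intro hq
        have hq' : r + m * q + m < n := by rwa [mul_add_one, ← add_assoc] at hq
        rw [← ih (by omega)]
        refine h _ _ ?_
        simp only [mul_add_one, ← add_assoc, Nat.mod_eq_of_lt hq']
    have to_mod : ∀ i : Fin n, a i = a ⟨(i : ℕ) % m, (Nat.mod_le _ _).trans_lt i.isLt⟩ := by
      intro i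
      rw [← key (i / m) (i % m) _ (by rw [Nat.mod_add_div]; exact i.isLt)]
      simp only [Nat.mod_add_div]
    intro i j hij
    rw [to_mod i, to_mod j]
    simp only [hij]
  · intro h i j hij
    refine h i j ?_
    rw [hij, Nat.mod_mod_of_dvd _ hmn, Nat.add_mod_right]

theorem commute_cycleMatrix_pow_and_tauMatrix_iff {m l : ℕ} {ξ : ℂ} {b : Fin m → ℂˣ}
    (hdist : Function.Injective (tauDiag l m ξ b)) (A : Matrix (Fin (l * m)) (Fin (l * m)) ℂ) :
    (Commute A (cycleMatrix (l * m) ^ m) ∧ Commute A (tauMatrix l m ξ b)) ↔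
      (A.IsDiag ∧ ∀ i j : Fin (l * m), (i : ℕ) % m = (j : ℕ) % m → A i i = A j j) := by
  rw [tauMatrix, Matrix.commute_diagonal_iff_isDiag hdist, and_comm]
  refine and_congr_right fun hA => ?_
  conv_lhs => rw [← hA.diagonal_diag]
  rw [commute_diagonal_cycleMatrix_pow_iff,
    forall_eq_add_mod_iff_forall_mod_eq (Dvd.intro_left l rfl)]
  rfl

/-- The invertible diagonal matrix whose `i`-th diagonal entry depends only on `i` modulo `m`. -/
noncomputable def periodicDiagonal (l m : ℕ) :
    (Fin m → ℂˣ) →* (Matrix (Fin (l * m)) (Fin (l * m)) ℂ)ˣ where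
  toFun w :=
    { val := Matrix.diagonal fun i => (w i.modNat : ℂ)
      inv := Matrix.diagonal fun i => ((w i.modNat)⁻¹ : ℂˣ)
      val_inv := by simp [-Units.val_inv_eq_inv_val]
      inv_val := by simp [-Units.val_inv_eq_inv_val] }
  map_one' := by ext1; simp
  map_mul' v w := by ext1; simp

theorem coe_periodicDiagonal (l m : ℕ) (w : Fin m → ℂˣ) :
    (periodicDiagonal l m w : Matrix (Fin (l * m)) (Fin (l * m)) ℂ) =
      Matrix.diagonal fun i => (w i.modNat : ℂ) := rfl

theorem modNat_castLE {l m : ℕ} (h : m ≤ l * m) (k : Fin m) : (Fin.castLE h k).modNat = k :=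
  Fin.ext (Nat.mod_eq_of_lt k.isLt)

theorem periodicDiagonal_injective {l m : ℕ} (hl : 1 ≤ l) :
    Function.Injective (periodicDiagonal l m) := by
  intro v w h
  have h' := congrArg Units.val h
  rw [coe_periodicDiagonal, coe_periodicDiagonal] at h'
  ext k
  simpa [modNat_castLE] using
    congrFun (Matrix.diagonal_injective h') (Fin.castLE (Nat.le_mul_of_pos_left m hl) k)

theorem mem_range_periodicDiagonal_iff {l m : ℕ} (hl : 1 ≤ l)
    (u : (Matrix (Fin (l * m)) (Fin (l * m)) ℂ)ˣ) :
    u ∈ (periodicDiagonal l m).range ↔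
      u.val.IsDiag ∧ ∀ i j : Fin (l * m), (i : ℕ) % m = (j : ℕ) % m → u.val i i = u.val j j := by
  constructor
  · rintro ⟨w, rfl⟩
    rw [coe_periodicDiagonal]
    refine ⟨Matrix.isDiag_diagonal _, fun i j hij => ?_⟩
    rw [Matrix.diagonal_apply_eq, Matrix.diagonal_apply_eq,
      show i.modNat = j.modNat from Fin.ext hij]
  · rintro ⟨hdiag, hper⟩
    have hu : ∀ i, IsUnit (u.val i i) := by
      have := u.isUnit
      rwa [← hdiag.diagonal_diag, Matrix.isUnit_diagonal, Pi.isUnit_iff] at this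
    refine ⟨fun k => (hu (Fin.castLE (Nat.le_mul_of_pos_left m hl) k)).unit, Units.ext ?_⟩
    rw [coe_periodicDiagonal]
    refine Eq.trans (congrArg Matrix.diagonal (funext fun i => ?_)) hdiag.diagonal_diag
    exact hper _ _ (Nat.mod_mod _ _)

theorem mem_centralizer_setOf_coe_eq_or_iff {M : Type*} [Monoid M] {x y : M} (hx : IsUnit x)
    (hy : IsUnit y) (u : Mˣ) :
    u ∈ Subgroup.centralizer {v : Mˣ | (v : M) = x ∨ (v : M) = y} ↔
      Commute (u : M) x ∧ Commute (u : M) y := by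
  rw [Subgroup.mem_centralizer_iff]
  constructor
  · intro h
    exact ⟨(congrArg Units.val (h hx.unit (Or.inl rfl))).symm,
      (congrArg Units.val (h hy.unit (Or.inr rfl))).symm⟩
  · rintro ⟨h₁, h₂⟩ v (rfl | rfl)
    · exact Units.ext h₁.eq.symm
    · exact Units.ext h₂.eq.symm

/-- **Stabilizer of the pair `(σ^m, τ_n^b(ξ))`.**
Let `n = m·l`, `ξ` a primitive `n`-th root of unity, and suppose the `n` diagonal entries
of `τ_n^b(ξ)` are pairwise distinct.  A matrix `A` commutes with both `σ^m` and `τ_n^b(ξ)`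
iff `A` is diagonal with `A_{ii} = A_{jj}` whenever `i ≡ j (mod m)`; consequently the
stabilizer of `(σ^m, τ_n^b(ξ))` under simultaneous conjugation — the subgroup of
`GL_n(ℂ)` centralizing both matrices — is isomorphic to `(ℂˣ)^m`. -/
theorem stabilizer_of_pair (m l : ℕ) (hm : 1 ≤ m) (hl : 1 ≤ l)
    (ξ : ℂ) (hξ : IsPrimitiveRoot ξ (l * m)) (b : Fin m → ℂˣ)
    (hdist : Function.Injective (tauDiag l m ξ b)) :
    (∀ A : Matrix (Fin (l * m)) (Fin (l * m)) ℂ,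
        (Commute A (cycleMatrix (l * m) ^ m) ∧ Commute A (tauMatrix l m ξ b)) ↔
          (A.IsDiag ∧ ∀ i j : Fin (l * m), (i : ℕ) % m = (j : ℕ) % m → A i i = A j j)) ∧
    Nonempty ((Subgroup.centralizer {u : (Matrix (Fin (l * m)) (Fin (l * m)) ℂ)ˣ |
        (u : Matrix (Fin (l * m)) (Fin (l * m)) ℂ) = cycleMatrix (l * m) ^ m ∨
        (u : Matrix (Fin (l * m)) (Fin (l * m)) ℂ) = tauMatrix l m ξ b}) ≃*
      (Fin m → ℂˣ)) := by
  refine ⟨commute_cycleMatrix_pow_and_tauMatrix_iff hdist, ⟨?_⟩⟩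
  have hn : l * m ≠ 0 := Nat.mul_ne_zero (by omega) (by omega)
  refine (MulEquiv.subgroupCongr ?_).trans
    (MonoidHom.ofInjective (periodicDiagonal_injective hl)).symm
  ext u
  rw [mem_centralizer_setOf_coe_eq_or_iff ((isUnit_cycleMatrix hn).pow m)
      (isUnit_tauMatrix (hξ.ne_zero hn) b),
    commute_cycleMatrix_pow_and_tauMatrix_iff hdist, mem_range_periodicDiagonal_iff hl]
end

section
/- Let x, y, s, u ∈ GL_n(ℂ) and c ∈ ℂ^×, and suppose y = s·u = u·s where s is diagonalizable and u is unipotent, i.e., (u − I_n)^n = 0. Then x·y·x⁻¹ = c·y if and only if both x·s·x⁻¹ = c·s and x·u·x⁻¹ = u. -/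
/-- A diagonal matrix over a field acts as a semisimple endomorphism. -/
lemma Matrix.isSemisimple_toLinAlgEquiv'_diagonal {ι K : Type*} [Fintype ι] [DecidableEq ι]
    [Field K] (d : ι → K) :
    Module.End.IsSemisimple (Matrix.toLinAlgEquiv' (Matrix.diagonal d)) := by
  classical
  let p : Polynomial K := ∏ a ∈ Finset.univ.image d, (Polynomial.X - Polynomial.C a)
  have hp : p.Separable :=
    Polynomial.separable_prod_X_sub_C_iff'.mpr fun _ _ _ _ h => h
  have hd : Polynomial.aeval d p = 0 := by
    ext i
    have hi : Polynomial.aeval (d i) p = 0 := by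
      rw [map_prod]
      exact Finset.prod_eq_zero (Finset.mem_image_of_mem d (Finset.mem_univ i)) (by simp)
    rwa [Polynomial.aeval_pi_apply]
  refine Module.End.isSemisimple_of_squarefree_aeval_eq_zero hp.squarefree ?_
  rw [Polynomial.aeval_algHom_apply, ← Matrix.diagonalAlgHom_apply (R := K),
    Polynomial.aeval_algHom_apply, hd, map_zero, map_zero]

/-- Semisimplicity of the endomorphism attached to a matrix is invariant under conjugation. -/
lemma Matrix.isSemisimple_toLinAlgEquiv'_conj {ι K : Type*} [Fintype ι] [DecidableEq ι]
    [Field K] {g a : Matrix ι ι K} (hg : IsUnit g)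
    (ha : Module.End.IsSemisimple (Matrix.toLinAlgEquiv' a)) :
    Module.End.IsSemisimple (Matrix.toLinAlgEquiv' (g * a * g⁻¹)) := by
  have hdet := (Matrix.isUnit_iff_isUnit_det g).mp hg
  have : Invertible g := Matrix.invertibleOfIsUnitDet g hdet
  refine ((Matrix.toLinearEquiv' g this).isSemisimple_iff _ _ ?_).mp ha
  change Matrix.toLin' g ∘ₗ Matrix.toLin' a = Matrix.toLin' (g * a * g⁻¹) ∘ₗ Matrix.toLin' g
  rw [← Matrix.toLin'_mul, ← Matrix.toLin'_mul, Matrix.nonsing_inv_mul_cancel_right _ _ hdet]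

/-- Uniqueness of the additive Jordan decomposition, for matrices over a perfect field. -/
lemma Matrix.isNilpotent_isSemisimple_unique {ι K : Type*} [Fintype ι] [DecidableEq ι]
    [Field K] [PerfectField K] {n₁ s₁ n₂ s₂ : Matrix ι ι K}
    (hn₁ : IsNilpotent n₁) (hs₁ : Module.End.IsSemisimple (Matrix.toLinAlgEquiv' s₁))
    (hn₂ : IsNilpotent n₂) (hs₂ : Module.End.IsSemisimple (Matrix.toLinAlgEquiv' s₂))
    (hc₁ : Commute n₁ s₁) (hc₂ : Commute n₂ s₂) (h : n₁ + s₁ = n₂ + s₂) :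
    n₁ = n₂ ∧ s₁ = s₂ := by
  have key := Module.End.isNilpotent_isSemisimple_unique
    (hn₁.map Matrix.toLinAlgEquiv') hs₁ (hn₂.map Matrix.toLinAlgEquiv') hs₂
    (hc₁.map Matrix.toLinAlgEquiv') (hc₂.map Matrix.toLinAlgEquiv')
    (by rw [← map_add, h, map_add])
  exact ⟨Matrix.toLinAlgEquiv'.injective key.1, Matrix.toLinAlgEquiv'.injective key.2⟩


/-- **Jordan decomposition splits the twisted conjugation equation.**
Let `x, y, s, u ∈ GL_n(ℂ)` and `c ∈ ℂˣ`, with `y = s·u = u·s` the multiplicative Jordan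
decomposition of `y` (`s` diagonalizable, `u` unipotent).  Then `x·y·x⁻¹ = c·y` if and
only if `x·s·x⁻¹ = c·s` and `x·u·x⁻¹ = u`. -/
theorem twisted_conj_iff_jordan (n : ℕ) (x y s u : Matrix (Fin n) (Fin n) ℂ)
    (hx : IsUnit x) (hy : IsUnit y) (hs : IsUnit s) (hu : IsUnit u)
    (c : ℂ) (hc : c ≠ 0)
    (hdecomp : y = s * u) (hcommsu : s * u = u * s)
    (hsdiag : ∃ (g : Matrix (Fin n) (Fin n) ℂ) (d : Fin n → ℂ),
      IsUnit g ∧ s = g * Matrix.diagonal d * g⁻¹)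
    (hunip : (u - 1) ^ n = 0) :
    x * y * x⁻¹ = c • y ↔ (x * s * x⁻¹ = c • s ∧ x * u * x⁻¹ = u) := by
  have hxd := (Matrix.isUnit_iff_isUnit_det x).mp hx
  have conj_mul (a b : Matrix (Fin n) (Fin n) ℂ) :
      x * (a * b) * x⁻¹ = x * a * x⁻¹ * (x * b * x⁻¹) := by
    simp only [Matrix.mul_assoc, Matrix.nonsing_inv_mul_cancel_left _ _ hxd]
  constructor
  · intro h
    have hss : Module.End.IsSemisimple (Matrix.toLinAlgEquiv' s) := by
      obtain ⟨g, d, hg, rfl⟩ := hsdiag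
      exact Matrix.isSemisimple_toLinAlgEquiv'_conj hg
        (Matrix.isSemisimple_toLinAlgEquiv'_diagonal d)
    have hcomm : Commute s (u - 1) := Commute.sub_right hcommsu (Commute.one_right s)
    have hnil : IsNilpotent (s * (u - 1)) := hcomm.isNilpotent_mul_left ⟨n, hunip⟩
    have hns : Commute (s * (u - 1)) s := (Commute.refl s).mul_left hcomm.symm
    have hnil' : IsNilpotent (x * (s * (u - 1)) * x⁻¹) := by
      obtain ⟨k, hk⟩ := hnil
      refine ⟨k, ?_⟩
      have := Units.conj_pow hx.unit (s * (u - 1)) k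
      rw [Matrix.coe_units_inv, hx.unit_spec] at this
      rw [this, hk, mul_zero, zero_mul]
    have hsum : s * (u - 1) + s = y := by rw [hdecomp, mul_sub, mul_one, sub_add_cancel]
    have hconj : x * s * x⁻¹ = c • s :=
      (Matrix.isNilpotent_isSemisimple_unique hnil'
        (Matrix.isSemisimple_toLinAlgEquiv'_conj hx hss) (hnil.smul c)
        (by rw [map_smul]; exact Module.End.IsSemisimple_smul c hss)
        (by rw [Commute, SemiconjBy, ← conj_mul, hns.eq, conj_mul])
        ((hns.smul_left c).smul_right c)
        (by rw [← add_mul, ← mul_add, ← smul_add, hsum, h])).2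
    refine ⟨hconj, ?_⟩
    rw [hdecomp, conj_mul, hconj, smul_mul_assoc] at h
    exact hs.mul_left_cancel (smul_right_injective _ hc h)
  · rintro ⟨h₁, h₂⟩
    rw [hdecomp, conj_mul, h₁, h₂, smul_mul_assoc]
end

section
/- Let n = m·l with m, l ≥ 1 and let ξ ∈ ℂ be a primitive n-th root of unity. Let R be the quotient of the polynomial ring ℂ[x_{ij}, y_{ij} (1 ≤ i, j ≤ n), u, v] by the ideal generated by u·det(x) − 1, v·det(y) − 1, and the n² entries of the matrix x·y − ξ^m·y·x (so that R is the coordinate ring of the affine variety {(X, Y) ∈ GL_n(ℂ) × GL_n(ℂ) : X·Y·X⁻¹·Y⁻¹ = ξ^m·I_n}). Then the Krull dimension of R equals n² + m. -/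
/-- The variables `x_{ij}`, `y_{ij}` (`1 ≤ i, j ≤ n`), `u`, `v` of the coordinate ring of
the commutator fiber. -/
abbrev CommFiberVar (n : ℕ) : Type := (Fin n × Fin n) ⊕ (Fin n × Fin n) ⊕ Fin 2

/-- The matrix `x = (x_{ij})` of indeterminates. -/
noncomputable def Xmat (n : ℕ) : Matrix (Fin n) (Fin n) (MvPolynomial (CommFiberVar n) ℂ) :=
  Matrix.of fun i j => MvPolynomial.X (Sum.inl (i, j))

/-- The matrix `y = (y_{ij})` of indeterminates. -/
noncomputable def Ymat (n : ℕ) : Matrix (Fin n) (Fin n) (MvPolynomial (CommFiberVar n) ℂ) :=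
  Matrix.of fun i j => MvPolynomial.X (Sum.inr (Sum.inl (i, j)))

/-- The ideal generated by `u·det(x) − 1`, `v·det(y) − 1` and the `n²` entries of
`x·y − a·y·x`, whose quotient is the coordinate ring of the affine variety
`{(X, Y) ∈ GL_n(ℂ)² : X·Y·X⁻¹·Y⁻¹ = a·I_n}`. -/
noncomputable def commFiberIdeal (n : ℕ) (a : ℂ) : Ideal (MvPolynomial (CommFiberVar n) ℂ) :=
  Ideal.span
    ({MvPolynomial.X (Sum.inr (Sum.inr 0)) * (Xmat n).det - 1,
      MvPolynomial.X (Sum.inr (Sum.inr 1)) * (Ymat n).det - 1} ∪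
      {p | ∃ i j : Fin n, p = (Xmat n * Ymat n - a • (Ymat n * Xmat n)) i j})

section

open Algebra
open scoped IntermediateField.algebraAdjoinAdjoin

universe u

theorem ringKrullDim_eq_of_isIntegral {A B : Type*} [CommRing A] [CommRing B] [Algebra A B]
    [Algebra.IsIntegral A B] (h : Function.Injective (algebraMap A B)) :
    ringKrullDim A = ringKrullDim B := by
  apply le_antisymm
  · refine iSup_le fun p => ?_
    obtain ⟨Q, -, hQ, hQ'⟩ := Ideal.exists_ideal_over_prime_of_isIntegral (S := B) p.head.asIdeal ⊥
      (by rw [Ideal.comap_bot_of_injective _ h]; exact bot_le)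
    have : Q.LiesOver p.head.asIdeal := ⟨hQ'.symm⟩
    obtain ⟨L, hL, -⟩ := Ideal.exists_ltSeries_of_hasGoingUp p Q
    rw [← hL]
    exact Order.LTSeries.length_le_krullDim L
  · refine Order.krullDim_le_of_strictMono (PrimeSpectrum.comap (algebraMap A B)) fun I J hIJ => ?_
    exact Ideal.IsIntegral.comap_lt_comap (R := A) (I := I.asIdeal) (J := J.asIdeal) hIJ

theorem exists_ringKrullDim_eq_trdeg_eq (k A : Type*) [Field k] [CommRing A] [IsDomain A]
    [Algebra k A] [Algebra.FiniteType k A] :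
    ∃ s : ℕ, ringKrullDim A = s ∧ Algebra.trdeg k A = s := by
  obtain ⟨s, g, hg, hfin⟩ := exists_integral_inj_algHom_of_fg k A
  let _ := g.toRingHom.toAlgebra
  have : IsScalarTower k (MvPolynomial (Fin s) k) A := .of_algebraMap_eq' g.comp_algebraMap.symm
  have : Algebra.IsIntegral (MvPolynomial (Fin s) k) A := ⟨hfin⟩
  have : FaithfulSMul (MvPolynomial (Fin s) k) A :=
    (faithfulSMul_iff_algebraMap_injective _ _).2 hg
  refine ⟨s, ?_, ?_⟩
  · rw [← ringKrullDim_eq_of_isIntegral (A := MvPolynomial (Fin s) k) hg,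
      MvPolynomial.ringKrullDim_of_isNoetherianRing, ringKrullDim_eq_zero_of_field]
    simp
  · have := lift_trdeg_add_eq k (MvPolynomial (Fin s) k) A
    rw [MvPolynomial.trdeg_of_isDomain, trdeg_eq_zero] at this
    simpa [eq_comm] using this

theorem exists_intermediateField_trdeg_le {k K : Type u} [Field k] [Field K] [Algebra k K]
    (S : Set K) : ∃ M : IntermediateField k K, S ⊆ M ∧ (∀ x : K, IsAlgebraic M x → x ∈ M) ∧
      Algebra.trdeg k M ≤ Cardinal.mk S := by
  let F := IntermediateField.adjoin k S
  let M := algebraicClosure F K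
  refine ⟨M.restrictScalars k, ?_, ?_, ?_⟩
  · intro x hx
    exact M.algebraMap_mem ⟨x, IntermediateField.subset_adjoin k S hx⟩
  · intro x hx
    change x ∈ M
    have h : IsAlgebraic M x := hx
    rw [mem_algebraicClosure_iff]
    exact h.restrictScalars F
  · change Algebra.trdeg k M ≤ _
    let A := Algebra.adjoin k S
    have : FaithfulSMul F M :=
      (faithfulSMul_iff_algebraMap_injective F M).2 (algebraMap F M).injective
    have h1 := trdeg_add_eq k F (A := M)
    have h2 := trdeg_add_eq k A (A := F)
    rw [trdeg_eq_zero (R := F) (A := M), add_zero] at h1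
    rw [trdeg_eq_zero (R := A) (A := F), add_zero] at h2
    rw [← h1, ← h2]
    have h3 : A = (MvPolynomial.aeval ((↑) : S → K) : _ →ₐ[k] K).range := by
      rw [← Algebra.adjoin_range_eq_range_aeval, Subtype.range_coe]
    rw [h3]
    refine (trdeg_le_of_surjective _ (AlgHom.rangeRestrict_surjective _)).trans ?_
    simp [MvPolynomial.trdeg_of_isDomain]


theorem exists_intermediateField_trdeg_le_add {k K : Type u} [Field k] [Field K] [Algebra k K]
    (A : Subalgebra k K) (S : Set K) :
    ∃ M : IntermediateField k K, (A : Set K) ⊆ M ∧ S ⊆ M ∧ (∀ x : K, IsAlgebraic M x → x ∈ M) ∧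
      Algebra.trdeg k M ≤ Algebra.trdeg k A + Cardinal.mk S := by
  let F := IntermediateField.adjoin k (A : Set K)
  obtain ⟨M, hSM, hM, hle⟩ := exists_intermediateField_trdeg_le (k := F) S
  refine ⟨M.restrictScalars k, ?_, hSM, hM, ?_⟩
  · exact fun x hx => M.algebraMap_mem ⟨x, IntermediateField.subset_adjoin k _ hx⟩
  · change Algebra.trdeg k M ≤ _
    have : FaithfulSMul F M :=
      (faithfulSMul_iff_algebraMap_injective F M).2 (algebraMap F M).injective
    have h1 := trdeg_add_eq k F (A := M)
    have h2 := trdeg_add_eq k (Algebra.adjoin k (A : Set K)) (A := F)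
    rw [trdeg_eq_zero (R := Algebra.adjoin k (A : Set K)) (A := F), add_zero,
      Algebra.adjoin_eq] at h2
    rw [← h1, ← h2]
    gcongr

theorem le_ringKrullDim_quotient {k K σ : Type u} [Field k] [Field K] [Algebra k K] [Finite σ]
    (I : Ideal (MvPolynomial σ k)) (ψ : MvPolynomial σ k →ₐ[k] K) (hψ : ∀ p ∈ I, ψ p = 0)
    {N m : ℕ} (S : Set K) (hS : Cardinal.mk S ≤ m)
    (h : ∀ M : IntermediateField k K, (∀ p, ψ p ∈ M) → S ⊆ M →
      (∀ x : K, IsAlgebraic M x → x ∈ M) → (N + m : ℕ) ≤ Algebra.trdeg k M) :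
    N ≤ ringKrullDim (MvPolynomial σ k ⧸ I) := by
  have : Algebra.FiniteType k ψ.range :=
    .of_surjective ψ.rangeRestrict ψ.rangeRestrict_surjective
  obtain ⟨s, hs, hs'⟩ := exists_ringKrullDim_eq_trdeg_eq k ψ.range
  obtain ⟨M, hψM, hSM, hM, hle⟩ := exists_intermediateField_trdeg_le_add ψ.range S
  have hNs : N ≤ s := by
    have h1 := (h M (fun p => hψM ⟨p, rfl⟩) hSM hM).trans (hle.trans (add_le_add hs'.le hS))
    norm_cast at h1
    omega
  have hdim : ringKrullDim ψ.range ≤ ringKrullDim (MvPolynomial σ k ⧸ I) :=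
    ringKrullDim_le_of_surjective (Ideal.Quotient.lift I (ψ.rangeRestrict : _ →+* ψ.range)
      fun p hp => Subtype.ext (hψ p hp))
      (Ideal.Quotient.lift_surjective_of_surjective I _ ψ.rangeRestrict_surjective)
  rw [hs] at hdim
  exact le_trans (mod_cast hNs) hdim

end

section

open Polynomial Module

theorem DFinsupp.basis_mk {ι R : Type*} {M : ι → Type*} [Semiring R] [DecidableEq ι]
    [∀ i, AddCommMonoid (M i)] [∀ i, Module R (M i)] {η : ι → Type*}
    (b : ∀ i, Basis (η i) R (M i)) (i : ι) (j : η i) :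
    DFinsupp.basis b ⟨i, j⟩ = DFinsupp.single i (b i j) := by
  classical
  rw [Basis.apply_eq_iff]
  ext ⟨i', j'⟩
  change (b i').repr (DFinsupp.single i (b i j) i') j' =
    Finsupp.single (⟨i, j⟩ : Σ i, η i) 1 ⟨i', j'⟩
  by_cases h : i = i'
  · subst h
    simp [Finsupp.single_apply]
  · rw [DFinsupp.single_eq_of_ne (Ne.symm h), map_zero, Finsupp.single_eq_of_ne (by aesop)]
    rfl

theorem exists_jordan_basis_quotient {K : Type*} [Field K] (c : K) (e : ℕ) :
    ∃ (d : ℕ) (b : Basis (Fin d) K (K[X] ⧸ Ideal.span {(X - C c) ^ e})), ∀ j,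
      (∃ i, (X : K[X]) • b i = c • b i) ∧
      ((X : K[X]) • b j = c • b j ∨ ∃ j', (X : K[X]) • b j = c • b j + b j') := by
  set A := K[X] ⧸ Ideal.span {(X - C c) ^ e}
  let g : A := Ideal.Quotient.mk _ (X - C c)
  have hg : g ^ e = 0 := by
    rw [← map_pow, Ideal.Quotient.eq_zero_iff_mem]
    exact Ideal.mem_span_singleton_self _
  have hint : IsIntegral K g := ⟨X ^ e, monic_X_pow e, by simp [hg]⟩
  have hmul (a : A) : (X : K[X]) • a = c • a + g * a := by
    obtain ⟨a, rfl⟩ := Ideal.Quotient.mk_surjective a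
    have h1 : (X : K[X]) • (Ideal.Quotient.mk _ a : A) = Ideal.Quotient.mk _ (X * a) := rfl
    have h2 : c • (Ideal.Quotient.mk _ a : A) = Ideal.Quotient.mk _ (C c * a) := by
      rw [← smul_eq_C_mul]; rfl
    rw [h1, h2, ← map_mul, ← map_add, ← add_mul, add_sub_cancel]
  have htop : Algebra.adjoin K {g} = ⊤ := by
    have hX : Algebra.adjoin K {(X - C c : K[X])} = ⊤ := by
      rw [eq_top_iff, ← adjoin_X]
      refine Algebra.adjoin_le (Set.singleton_subset_iff.2 ?_)
      have := add_mem (Algebra.self_mem_adjoin_singleton K (X - C c : K[X]))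
        (algebraMap_mem (Algebra.adjoin K {(X - C c : K[X])}) c)
      simpa using this
    have := congrArg (Subalgebra.map (Ideal.Quotient.mkₐ K (Ideal.span {(X - C c) ^ e}))) hX
    rw [AlgHom.map_adjoin, Set.image_singleton, Algebra.map_top,
      (AlgHom.range_eq_top _).2 (Ideal.Quotient.mkₐ_surjective K _)] at this
    exact this
  let pb := PowerBasis.ofAdjoinEqTop hint htop
  have hgen : pb.gen = g := PowerBasis.ofAdjoinEqTop_gen hint htop
  have hdim : g ^ pb.dim = 0 := by
    obtain ⟨i, -, hi⟩ := (dvd_prime_pow (prime_X (R := K)) e).1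
      (minpoly.dvd K g (p := X ^ e) (by simp [hg]))
    have := eq_of_monic_of_associated (minpoly.monic hint) (monic_X_pow i) hi
    have h2 : pb.dim = i := by
      rw [← pb.natDegree_minpoly, hgen, this, natDegree_X_pow]
    have h3 := minpoly.aeval K g
    rw [this] at h3
    simpa [h2] using h3
  refine ⟨pb.dim, pb.basis, fun j => ⟨⟨⟨pb.dim - 1, Nat.sub_lt j.pos one_pos⟩, ?_⟩, ?_⟩⟩
  · have hd : pb.dim - 1 + 1 = pb.dim := Nat.sub_add_cancel j.pos
    rw [hmul, pb.basis_eq_pow, hgen, ← pow_succ', Fin.val_mk, hd, hdim, add_zero]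
  rw [hmul, pb.basis_eq_pow, hgen, ← pow_succ']
  by_cases hj : j.1 + 1 < pb.dim
  · exact Or.inr ⟨⟨j.1 + 1, hj⟩, by rw [pb.basis_eq_pow, hgen]⟩
  · have : j.1 + 1 = pb.dim := by omega
    left
    rw [this, hdim, add_zero]

theorem exists_jordan_basis {K V : Type} [Field K] [IsAlgClosed K] [AddCommGroup V] [Module K V]
    [FiniteDimensional K V] (f : End K V) :
    ∃ (κ : Type) (_ : Fintype κ) (b : Basis κ K V), ∀ j, ∃ c : K, f.HasEigenvalue c ∧
      (f (b j) = c • b j ∨ ∃ j', f (b j) = c • b j + b j') := by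
  classical
  obtain ⟨ι, _, p, hp, e, ⟨E⟩⟩ :=
    Module.equiv_directSum_of_isTorsion (AEval.isTorsion_of_finiteDimensional K V f)
  have hroot (i : ι) : ∃ c : K, Ideal.span {(X - C c) ^ e i} = Submodule.span K[X] {p i ^ e i} := by
    have h1 := IsAlgClosed.degree_eq_one_of_irreducible K (hp i)
    obtain ⟨c, hc⟩ := exists_root_of_degree_eq_one h1
    refine ⟨c, Ideal.span_singleton_eq_span_singleton.2 (Associated.pow_pow ?_)⟩
    exact (irreducible_X_sub_C c).associated_of_dvd (hp i) (dvd_iff_isRoot.2 hc)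
  choose c hc using hroot
  have hb (i : ι) : ∃ (d : ℕ) (b : Basis (Fin d) K (K[X] ⧸ Submodule.span K[X] {p i ^ e i})),
      ∀ j, (∃ k, (X : K[X]) • b k = c i • b k) ∧
        ((X : K[X]) • b j = c i • b j ∨ ∃ j', (X : K[X]) • b j = c i • b j + b j') := by
    rw [← hc i]
    exact exists_jordan_basis_quotient (c i) (e i)
  choose d b hb using hb
  let F := (AEval'.of f).trans (E.restrictScalars K)
  let B := (DFinsupp.basis b).map F.symm
  have hF (v : V) : F (f v) = (X : K[X]) • F v := by
    simp [F, ← AEval'.X_smul_of]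
  have hB (i : ι) (j : Fin (d i)) : F (B ⟨i, j⟩) = DirectSum.lof K[X] ι _ i (b i j) := by
    simp only [B, Basis.map_apply, LinearEquiv.apply_symm_apply, DFinsupp.basis_mk]
    rfl
  have hX (i : ι) (j : Fin (d i)) (a : K[X] ⧸ Submodule.span K[X] {p i ^ e i})
      (h : (X : K[X]) • b i j = c i • b i j + a) :
      F (f (B ⟨i, j⟩)) = F (c i • B ⟨i, j⟩) + DirectSum.lof K[X] ι _ i a := by
    rw [hF, hB, ← map_smul, h, map_add, map_smul F, hB]
    congr 1
    exact map_smul ((DirectSum.lof K[X] ι _ i).restrictScalars K) _ _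
  refine ⟨_, inferInstance, B, fun ⟨i, j⟩ => ⟨c i, ?_, ?_⟩⟩
  · obtain ⟨⟨k, hk⟩, -⟩ := hb i j
    refine Module.End.hasEigenvalue_of_hasEigenvector (x := B ⟨i, k⟩)
      (Module.End.hasEigenvector_iff.2 ⟨Module.End.mem_eigenspace_iff.2 (F.injective ?_),
        B.ne_zero _⟩)
    rw [hX i k 0 (by rw [hk, add_zero]), map_zero, add_zero]
  · obtain ⟨-, h | ⟨j', h⟩⟩ := hb i j
    · refine Or.inl (F.injective ?_)
      rw [hX i j 0 (by rw [h, add_zero]), map_zero, add_zero]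
    · refine Or.inr ⟨⟨i, j'⟩, F.injective ?_⟩
      rw [hX i j _ h, ← hB, map_add]

theorem exists_similar_of_hasEigenvalue_mem {K ι : Type} [Field K] [IsAlgClosed K] [Fintype ι]
    [DecidableEq ι] (L : Subfield K) (A : Matrix ι ι K)
    (hA : ∀ c, End.HasEigenvalue A.toLin' c → c ∈ L) :
    ∃ h J : Matrix ι ι K, h.det ≠ 0 ∧ A * h = h * J ∧ ∀ i j, J i j ∈ L := by
  classical
  obtain ⟨κ, _, b, hb⟩ := exists_jordan_basis A.toLin'
  let σ : κ ≃ ι := b.indexEquiv (Pi.basisFun K ι)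
  let B := b.reindex σ
  refine ⟨(Pi.basisFun K ι).toMatrix B, LinearMap.toMatrix B B A.toLin', ?_, ?_, fun i j => ?_⟩
  · exact (Matrix.isUnit_det_of_right_inverse
      ((Pi.basisFun K ι).toMatrix_mul_toMatrix_flip B)).ne_zero
  · rw [basis_toMatrix_mul_linearMap_toMatrix]
    ext i j
    simp [LinearMap.toMatrix_apply, Matrix.mul_apply, Basis.toMatrix_apply, Matrix.mulVec,
      dotProduct]
  · have h0 (i j) : (B.repr (B j)) i ∈ L := by
      rw [B.repr_self, Finsupp.single_apply]
      split_ifs <;> simp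
    have hB (j : κ) : b j = B (σ j) := by simp [B]
    obtain ⟨c, hc, h⟩ := hb (σ.symm j)
    simp only [hB, Equiv.apply_symm_apply] at h
    rw [LinearMap.toMatrix_apply]
    obtain h | ⟨j', h⟩ := h
    · rw [h, map_smul]
      exact L.mul_mem (hA c hc) (h0 _ _)
    · rw [h, map_add, map_smul]
      exact L.add_mem (L.mul_mem (hA c hc) (h0 _ _)) (h0 _ _)

end

section

open Module

theorem exists_coordinates {K V I : Type} [Field K] [AddCommGroup V] [Module K V]
    [FiniteDimensional K V] (φ : I → Dual K V) (hφ : ∀ v, (∀ i, φ i v = 0) → v = 0) :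
    ∃ (κ : Type) (_ : Fintype κ) (a : κ → I) (e : V ≃ₗ[K] (κ → K)), Function.Injective a ∧
      Fintype.card κ = finrank K V ∧ ∀ v t, e v t = φ (a t) v := by
  obtain ⟨κ, a, ha, hspan, hli⟩ := exists_linearIndependent' K φ
  have : Finite κ := hli.finite
  have : Fintype κ := Fintype.ofFinite κ
  have hzero (v : V) (hv : ∀ t, φ (a t) v = 0) : v = 0 := by
    refine hφ v fun i => ?_
    have hi : φ i ∈ Submodule.span K (Set.range (φ ∘ a)) :=
      hspan ▸ Submodule.subset_span (Set.mem_range_self i)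
    refine Submodule.span_induction (p := fun ψ _ => ψ v = 0) ?_ (by simp) ?_ ?_ hi
    · rintro _ ⟨t, rfl⟩
      exact hv t
    · intro x y _ _ hx hy
      simp [hx, hy]
    · intro c x _ hx
      simp [hx]
  let f : V →ₗ[K] (κ → K) := LinearMap.pi fun t => φ (a t)
  have hf : Function.Injective f := by
    rw [injective_iff_map_eq_zero]
    exact fun v hv => hzero v fun t => congrFun hv t
  have hcard : Fintype.card κ = finrank K V := by
    apply le_antisymm
    · rw [← Subspace.dual_finrank_eq]
      exact hli.fintype_card_le_finrank
    · simpa using LinearMap.finrank_le_finrank_of_injective hf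
  exact ⟨κ, this, a, LinearEquiv.ofInjectiveOfFinrankEq f hf (by simp [hcard]), ha, hcard,
    fun v t => rfl⟩

theorem exists_det_ne_zero_of_coordinates {k K ι κ : Type} [Field k] [Infinite k] [Field K]
    [Algebra k K] [Fintype ι] [DecidableEq ι] [Fintype κ] (W : Submodule K (Matrix ι ι K))
    (e : W ≃ₗ[K] (κ → K)) (h₀ : W) (hh₀ : h₀.1.det ≠ 0) :
    ∃ h : W, h.1.det ≠ 0 ∧ ∀ t, e h t ∈ (algebraMap k K).range := by
  classical
  let P : Matrix ι ι (MvPolynomial κ K) := Matrix.of fun i j =>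
    ∑ t, MvPolynomial.X t * MvPolynomial.C ((e.symm (Pi.single t 1)).1 i j)
  have hP (v : κ → K) : MvPolynomial.eval v P.det = (e.symm v).1.det := by
    rw [RingHom.map_det]
    congr 1
    ext i j
    conv_rhs => rw [pi_eq_sum_univ' v]
    simp [P, Matrix.sum_apply]
  by_contra! H
  refine hh₀ ?_
  have hzero : P.det = 0 := by
    refine MvPolynomial.funext_set (fun _ => (algebraMap k K).range) (fun _ => ?_) fun v hv => ?_
    · simpa using Set.infinite_range_of_injective (algebraMap k K).injective
    · rw [hP, map_zero]
      by_contra h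
      obtain ⟨t, ht⟩ := H _ h
      rw [e.apply_symm_apply] at ht
      exact ht (hv t trivial)
  rw [← e.symm_apply_apply h₀, ← hP, hzero, map_zero]

theorem card_image_pow_charpoly_roots_le {K ι : Type} [Field K] [DecidableEq K] [Fintype ι]
    [DecidableEq ι] {l m : ℕ} (hl : 1 ≤ l) (hι : Fintype.card ι = l * m)
    {ζ : K} (hζ : IsPrimitiveRoot ζ l)
    {X Y : Matrix ι ι K} (hX : X.det ≠ 0) (hY : Y.det ≠ 0) (hXY : X * Y = ζ • (Y * X)) :
    (X.charpoly.roots.toFinset.image (· ^ l)).card ≤ m := by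
  set E := X.charpoly.roots.toFinset
  have hE (c : K) : c ∈ E ↔ ∃ v, v ≠ 0 ∧ X.mulVec v = c • v := by
    rw [Multiset.mem_toFinset, Polynomial.mem_roots X.charpoly_monic.ne_zero,
      ← Matrix.charpoly_toLin', ← Module.End.hasEigenvalue_iff_isRoot_charpoly]
    constructor
    · intro h
      obtain ⟨v, hv⟩ := h.exists_hasEigenvector
      exact ⟨v, hv.2, by simpa using hv.apply_eq_smul⟩
    · rintro ⟨v, hv, h⟩
      exact End.hasEigenvalue_of_hasEigenvector (x := v)
        ⟨End.mem_eigenspace_iff.2 (by simpa using h), hv⟩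
  have hinj {A : Matrix ι ι K} (hA : A.det ≠ 0) {v : ι → K} (hv : v ≠ 0) : A.mulVec v ≠ 0 :=
    fun h => hA (Matrix.exists_mulVec_eq_zero_iff.1 ⟨v, hv, h⟩)
  have hmul (c : K) (hc : c ∈ E) : ζ * c ∈ E := by
    obtain ⟨v, hv, h⟩ := (hE c).1 hc
    refine (hE _).2 ⟨Y.mulVec v, hinj hY hv, ?_⟩
    rw [Matrix.mulVec_mulVec, hXY, Matrix.smul_mulVec, ← Matrix.mulVec_mulVec, h,
      Matrix.mulVec_smul, smul_smul]
  have hmul' (c : K) (hc : c ∈ E) (i : ℕ) : ζ ^ i * c ∈ E := by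
    induction i with
    | zero => simpa
    | succ i ih => simpa [pow_succ', mul_assoc] using hmul _ ih
  have hne (c : K) (hc : c ∈ E) : c ≠ 0 := by
    rintro rfl
    obtain ⟨v, hv, h⟩ := (hE 0).1 hc
    exact hinj hX hv (by simpa using h)
  have hcard : E.card ≤ Fintype.card ι := by
    refine (Multiset.toFinset_card_le _).trans ((Polynomial.card_roots' _).trans ?_)
    rw [X.charpoly_natDegree_eq_dim]
  refine Nat.le_of_mul_le_mul_left (((E.mul_card_image_le_card l) ?_).trans (hcard.trans hι.le)) hl
  intro b hb
  obtain ⟨c, hc, rfl⟩ := Finset.mem_image.1 hb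
  refine Finset.le_card_of_inj_on_range (fun i => ζ ^ i * c) (fun i _ => ?_) fun i hi j hj h => ?_
  · refine Finset.mem_filter.2 ⟨hmul' c hc i, ?_⟩
    rw [mul_pow, ← pow_mul, mul_comm i, pow_mul, hζ.pow_eq_one, one_pow, one_mul]
  · exact hζ.pow_inj hi hj (mul_right_cancel₀ (hne c hc) h)

theorem Subfield.exists_linear_retraction {K : Type*} [Field K] (M : Subfield K) :
    ∃ φ : K →ₗ[M] K, (∀ x, φ x ∈ M) ∧ ∀ x ∈ M, φ x = x := by
  obtain ⟨φ, hφ⟩ := LinearMap.exists_leftInverse_of_injective (Algebra.linearMap M K)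
    (LinearMap.ker_eq_bot.2 (algebraMap M K).injective)
  refine ⟨Algebra.linearMap M K ∘ₗ φ, fun x => (φ x).2, fun x hx => ?_⟩
  exact congrArg (algebraMap M K) (LinearMap.congr_fun hφ ⟨x, hx⟩)

theorem Matrix.map_mul_of_left_mem {K ι : Type*} [Field K] [Fintype ι] {M : Subfield K}
    (φ : K →ₗ[M] K) {A : Matrix ι ι K} (hA : ∀ i j, A i j ∈ M) (B : Matrix ι ι K) :
    (A * B).map φ = A * B.map φ := by
  ext i j
  simp only [Matrix.map_apply, Matrix.mul_apply, map_sum]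
  exact Finset.sum_congr rfl fun t _ => φ.map_smul ⟨A i t, hA i t⟩ (B t j)

theorem Matrix.map_mul_of_right_mem {K ι : Type*} [Field K] [Fintype ι] {M : Subfield K}
    (φ : K →ₗ[M] K) {A : Matrix ι ι K} (hA : ∀ i j, A i j ∈ M) (B : Matrix ι ι K) :
    (B * A).map φ = B.map φ * A := by
  ext i j
  simp only [Matrix.map_apply, Matrix.mul_apply, map_sum]
  refine Finset.sum_congr rfl fun t _ => ?_
  rw [mul_comm, mul_comm (φ _)]
  exact φ.map_smul ⟨A t j, hA t j⟩ (B i t)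

theorem exists_finset_entries_mem {k K ι : Type} [Field k] [Infinite k] [Field K] [IsAlgClosed K]
    [Algebra k K] [Fintype ι] [DecidableEq ι] {l m : ℕ} (hl : 1 ≤ l)
    (hι : Fintype.card ι = l * m) {ζ : k} (hζ : IsPrimitiveRoot ζ l) {X Y : Matrix ι ι K}
    (hX : X.det ≠ 0) (hY : Y.det ≠ 0) (hXY : X * Y = algebraMap k K ζ • (Y * X)) :
    ∃ S : Finset K, S.card ≤ Fintype.card ι ^ 2 + m ∧ ∀ M : IntermediateField k K,
      (S : Set K) ⊆ M → (∀ x, IsAlgebraic M x → x ∈ M) → ∀ i j, X i j ∈ M ∧ Y i j ∈ M := by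
  classical
  set z := algebraMap k K ζ with hz
  have hz0 : z ≠ 0 := by
    rw [hz, map_ne_zero]
    exact hζ.ne_zero (by omega)
  set Λ : Finset K := X.charpoly.roots.toFinset.image (· ^ l) with hΛ
  have hΛm : Λ.card ≤ m :=
    card_image_pow_charpoly_roots_le hl hι (hζ.map_of_injective (algebraMap k K).injective)
      hX hY hXY
  let L : Subfield K := sInf {N | ∃ M : IntermediateField k K, (Λ : Set K) ⊆ M ∧
    (∀ x, IsAlgebraic M x → x ∈ M) ∧ N = M.toSubfield}
  obtain ⟨h₀, J, hh₀, hJ, hJL⟩ := exists_similar_of_hasEigenvalue_mem L X (fun c hc => by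
    rw [Subfield.mem_sInf]
    rintro _ ⟨M, hM, hM', rfl⟩
    refine hM' c (IsAlgebraic.of_pow hl ?_)
    have : c ^ l ∈ M := by
      refine hM (Finset.mem_coe.2 (Finset.mem_image_of_mem _ ?_))
      rw [Multiset.mem_toFinset, Polynomial.mem_roots X.charpoly_monic.ne_zero,
        ← Matrix.charpoly_toLin', ← Module.End.hasEigenvalue_iff_isRoot_charpoly]
      exact hc
    exact isAlgebraic_algebraMap (⟨c ^ l, this⟩ : M))
  let W : Submodule K (Matrix ι ι K) :=
    LinearMap.ker (LinearMap.mulLeft K X - LinearMap.mulRight K J)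
  let W' : Submodule K (Matrix ι ι K) :=
    LinearMap.ker (LinearMap.mulLeft K X - z • LinearMap.mulRight K X)
  have hW (A) : A ∈ W ↔ X * A = A * J := by simp [W, sub_eq_zero]
  have hW' (A) : A ∈ W' ↔ X * A = z • (A * X) := by simp [W', sub_eq_zero]
  have hentry (V : Submodule K (Matrix ι ι K)) (v : V)
      (hv : ∀ p : ι × ι, (Matrix.entryLinearMap K K p.1 p.2 ∘ₗ V.subtype) v = 0) : v = 0 := by
    ext i j
    exact hv (i, j)
  obtain ⟨κ, _, a, e, ha, hκ, he⟩ := exists_coordinates (V := W) _ (hentry W)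
  obtain ⟨κ', _, a', e', ha', hκ', he'⟩ := exists_coordinates (V := W') _ (hentry W')
  have hYu : IsUnit Y.det := hY.isUnit
  have hle : finrank K W' ≤ finrank K W := by
    have hcomm : X * Y⁻¹ = z⁻¹ • (Y⁻¹ * X) := by
      have : Y⁻¹ * (X * Y) * Y⁻¹ = Y⁻¹ * (z • (Y * X)) * Y⁻¹ := by rw [hXY]
      rw [Matrix.mul_assoc, Matrix.mul_assoc, Matrix.mul_nonsing_inv _ hYu, mul_one,
        Matrix.mul_smul, ← Matrix.mul_assoc, Matrix.nonsing_inv_mul _ hYu, one_mul,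
        Matrix.smul_mul] at this
      rw [this, smul_smul, inv_mul_cancel₀ hz0, one_smul]
    let f : W' →ₗ[K] W := LinearMap.codRestrict W
      (LinearMap.mulLeft K Y⁻¹ ∘ₗ LinearMap.mulRight K h₀ ∘ₗ W'.subtype) fun B => by
        have hB := (hW' B.1).1 B.2
        rw [hW]
        simp only [LinearMap.comp_apply, LinearMap.mulLeft_apply, LinearMap.mulRight_apply,
          Submodule.subtype_apply]
        rw [← Matrix.mul_assoc, hcomm, Matrix.smul_mul, Matrix.mul_assoc, ← Matrix.mul_assoc X, hB,
          Matrix.smul_mul, Matrix.mul_smul, smul_smul, inv_mul_cancel₀ hz0, one_smul,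
          Matrix.mul_assoc, hJ, Matrix.mul_assoc, Matrix.mul_assoc]
    refine LinearMap.finrank_le_finrank_of_injective (f := f) ?_
    rw [injective_iff_map_eq_zero]
    intro B hB
    have hB' : Y⁻¹ * (B.1 * h₀) = 0 := congrArg Subtype.val hB
    have h1 : Y * (Y⁻¹ * (B.1 * h₀)) * h₀⁻¹ = 0 := by rw [hB', mul_zero, zero_mul]
    rw [← Matrix.mul_assoc, Matrix.mul_nonsing_inv _ hYu, one_mul, Matrix.mul_assoc,
      Matrix.mul_nonsing_inv _ hh₀.isUnit, mul_one] at h1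
    exact Subtype.ext h1
  obtain ⟨h, hh, hhk⟩ := exists_det_ne_zero_of_coordinates (k := k) W e ⟨h₀, (hW _).2 hJ⟩ hh₀
  refine ⟨Λ ∪ (Finset.univ \ Finset.univ.image a).image (fun p => h.1 p.1 p.2) ∪
    Finset.univ.image (fun t => Y (a' t).1 (a' t).2), ?_, fun M hSM hM => ?_⟩
  · have h1 : (Finset.univ \ Finset.univ.image a).card + Fintype.card κ = Fintype.card ι ^ 2 := by
      rw [← Finset.card_univ (α := κ), ← Finset.card_image_of_injective _ ha,
        Finset.card_sdiff_add_card_eq_card (Finset.subset_univ _), Finset.card_univ,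
        Fintype.card_prod, sq]
    have h2 := Finset.card_union_le (Λ ∪ (Finset.univ \ Finset.univ.image a).image
      (fun p => h.1 p.1 p.2)) (Finset.univ.image (fun t => Y (a' t).1 (a' t).2))
    have h3 := Finset.card_union_le Λ ((Finset.univ \ Finset.univ.image a).image
      (fun p => h.1 p.1 p.2))
    have h4 := Finset.card_image_le (s := Finset.univ \ Finset.univ.image a)
      (f := fun p => h.1 p.1 p.2)
    have h5 := Finset.card_image_le (s := Finset.univ) (f := fun t => Y (a' t).1 (a' t).2)
    rw [Finset.card_univ] at h5
    omega
  have hΛM : (Λ : Set K) ⊆ M := fun x hx =>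
    hSM (Finset.mem_coe.2 (Finset.mem_union_left _ (Finset.mem_union_left _ hx)))
  have hJM (i j) : J i j ∈ M.toSubfield := Subfield.mem_sInf.1 (hJL i j) _ ⟨M, hΛM, hM, rfl⟩
  have hhM (i j) : h.1 i j ∈ M.toSubfield := by
    by_cases hp : (i, j) ∈ Finset.univ.image a
    · obtain ⟨t, -, ht⟩ := Finset.mem_image.1 hp
      obtain ⟨c, hc⟩ := hhk t
      rw [he, ht] at hc
      exact (show _ = h.1 i j from hc) ▸ M.algebraMap_mem c
    · refine hSM (Finset.mem_coe.2 (Finset.mem_union_left _ (Finset.mem_union_right _ ?_)))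
      exact Finset.mem_image.2 ⟨(i, j), by simpa using hp, rfl⟩
  let _ := h.1.invertibleOfIsUnitDet hh.isUnit
  obtain ⟨φ, hφM, hφ⟩ := M.toSubfield.exists_linear_retraction
  have hXM (i j) : X i j ∈ M.toSubfield := by
    have hXφ : X.map φ * h.1 = X * h.1 := by
      have hhφ : h.1.map φ = h.1 := by
        ext i j
        exact hφ _ (hhM i j)
      rw [← Matrix.map_mul_of_right_mem φ hhM, (hW _).1 h.2,
        Matrix.map_mul_of_right_mem φ hJM, hhφ]
    have := congrFun (congrFun ((Matrix.mul_left_inj_of_invertible h.1).1 hXφ) i) j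
    exact (show φ (X i j) = X i j from this) ▸ hφM _
  refine fun i j => ⟨hXM i j, ?_⟩
  have hYW : Y ∈ W' := (hW' _).2 hXY
  have hzM : z ∈ M.toSubfield := M.algebraMap_mem ζ
  have hYφ : Y.map φ ∈ W' := by
    rw [hW', ← Matrix.map_mul_of_left_mem φ hXM, hXY, ← Matrix.map_mul_of_right_mem φ hXM]
    ext i j
    exact φ.map_smul ⟨z, hzM⟩ _
  have heq : (⟨Y.map φ, hYφ⟩ : W') = ⟨Y, hYW⟩ := by
    apply e'.injective
    ext t
    rw [he', he']
    exact hφ _ (hSM (Finset.mem_coe.2 (Finset.mem_union_right _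
      (Finset.mem_image_of_mem _ (Finset.mem_univ t)))))
  have := congrFun (congrFun (congrArg Subtype.val heq) i) j
  exact (show φ (Y i j) = Y i j from this) ▸ hφM _

end

theorem ringKrullDim_le_of_forall_quotient_le {A : Type*} [CommRing A] {N : WithBot ℕ∞}
    (h : ∀ P : Ideal A, P.IsPrime → ringKrullDim (A ⧸ P) ≤ N) : ringKrullDim A ≤ N := by
  rcases subsingleton_or_nontrivial A with hA | hA
  · simp [ringKrullDim_eq_bot_of_subsingleton]
  · rw [ringKrullDim, Order.krullDim_eq_iSup_coheight_of_nonempty,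
      WithBot.coe_iSup (OrderTop.bddAbove _)]
    refine iSup_le fun p => ?_
    rw [Order.coheight_eq_krullDim_Ici]
    have hp : PrimeSpectrum.zeroLocus (p.asIdeal : Set A) = Set.Ici p := by
      ext q
      exact SetLike.coe_subset_coe
    exact hp ▸ ringKrullDim_quotient p.asIdeal ▸ h p.asIdeal p.isPrime

theorem Xmat_mul_Ymat_map {n : ℕ} {a : ℂ} {K : Type*} [CommRing K] [Algebra ℂ K]
    (ψ : MvPolynomial (CommFiberVar n) ℂ →ₐ[ℂ] K) (hψ : ∀ p ∈ commFiberIdeal n a, ψ p = 0) :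
    (Xmat n).map ψ * (Ymat n).map ψ = algebraMap ℂ K a • ((Ymat n).map ψ * (Xmat n).map ψ) ∧
    ψ (.X (.inr (.inr 0))) * ((Xmat n).map ψ).det = 1 ∧
    ψ (.X (.inr (.inr 1))) * ((Ymat n).map ψ).det = 1 := by
  have hdet (A : Matrix (Fin n) (Fin n) (MvPolynomial (CommFiberVar n) ℂ)) :
      (A.map ψ).det = ψ A.det := (AlgHom.map_det ψ A).symm
  refine ⟨?_, ?_, ?_⟩
  · ext i j
    have h := hψ _ (Ideal.subset_span (Or.inr ⟨i, j, rfl⟩))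
    rw [Matrix.sub_apply, Matrix.smul_apply, map_sub, map_smul, sub_eq_zero] at h
    rw [Matrix.smul_apply, smul_eq_mul, ← Algebra.smul_def]
    simpa only [Matrix.mul_apply, map_sum, map_mul, Matrix.map_apply] using h
  · have h := hψ _ (Ideal.subset_span (Or.inl (Or.inl rfl)))
    rw [hdet, ← map_mul, ← sub_eq_zero, ← h, map_sub, map_one]
  · have h := hψ _ (Ideal.subset_span (Or.inl (Or.inr rfl)))
    rw [hdet, ← map_mul, ← sub_eq_zero, ← h, map_sub, map_one]

theorem eval_mem_of_Xmat_Ymat_mem {n : ℕ} {a : ℂ} {K : Type*} [Field K] [Algebra ℂ K]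
    (ψ : MvPolynomial (CommFiberVar n) ℂ →ₐ[ℂ] K) (hψ : ∀ p ∈ commFiberIdeal n a, ψ p = 0)
    (M : IntermediateField ℂ K) (hM : ∀ i j, ψ (Xmat n i j) ∈ M ∧ ψ (Ymat n i j) ∈ M)
    (p : MvPolynomial (CommFiberVar n) ℂ) : ψ p ∈ M := by
  obtain ⟨-, hu, hv⟩ := Xmat_mul_Ymat_map ψ hψ
  have hdet (A : Matrix (Fin n) (Fin n) K) (hA : ∀ i j, A i j ∈ M) : A.det ∈ M := by
    rw [Matrix.det_apply]
    exact sum_mem fun σ _ => zsmul_mem (prod_mem fun i _ => hA _ _) _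
  induction p using MvPolynomial.induction_on with
  | C c => exact ψ.commutes c ▸ M.algebraMap_mem c
  | add p q hp hq => exact map_add ψ p q ▸ add_mem hp hq
  | mul_X p i hp =>
    rw [map_mul]
    refine mul_mem hp ?_
    match i with
    | .inl (i, j) => exact (hM i j).1
    | .inr (.inl (i, j)) => exact (hM i j).2
    | .inr (.inr 0) =>
      rw [eq_inv_of_mul_eq_one_left hu]
      exact inv_mem (hdet _ fun i j => (hM i j).1)
    | .inr (.inr 1) =>
      rw [eq_inv_of_mul_eq_one_left hv]
      exact inv_mem (hdet _ fun i j => (hM i j).2)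

theorem ringKrullDim_commFiber_le {m l : ℕ} (hl : 1 ≤ l) {ζ : ℂ} (hζ : IsPrimitiveRoot ζ l) :
    ringKrullDim (MvPolynomial (CommFiberVar (l * m)) ℂ ⧸ commFiberIdeal (l * m) ζ) ≤
      ((l * m) ^ 2 + m : ℕ) := by
  refine ringKrullDim_le_of_forall_quotient_le fun P hP => ?_
  set R := MvPolynomial (CommFiberVar (l * m)) ℂ ⧸ commFiberIdeal (l * m) ζ
  let A := R ⧸ P
  let K := AlgebraicClosure (FractionRing A)
  have hinj : Function.Injective (algebraMap A K) := by
    rw [IsScalarTower.algebraMap_eq A (FractionRing A) K]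
    exact (algebraMap (FractionRing A) K).injective.comp (IsFractionRing.injective A _)
  let f : A →ₐ[ℂ] K := IsScalarTower.toAlgHom ℂ A K
  let π : MvPolynomial (CommFiberVar (l * m)) ℂ →ₐ[ℂ] A :=
    (Ideal.Quotient.mkₐ ℂ P).comp (Ideal.Quotient.mkₐ ℂ _)
  have hπ : Function.Surjective π :=
    (Ideal.Quotient.mkₐ_surjective ℂ P).comp (Ideal.Quotient.mkₐ_surjective ℂ _)
  let ψ := f.comp π
  have hψ (p) (hp : p ∈ commFiberIdeal (l * m) ζ) : ψ p = 0 := by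
    have : Ideal.Quotient.mkₐ ℂ (commFiberIdeal (l * m) ζ) p = 0 :=
      Ideal.Quotient.eq_zero_iff_mem.2 hp
    simp only [ψ, π, AlgHom.comp_apply, this, map_zero]
  obtain ⟨h1, h2, h3⟩ := Xmat_mul_Ymat_map ψ hψ
  obtain ⟨S, hS, hSM⟩ := exists_finset_entries_mem hl (Fintype.card_fin _) hζ
    (right_ne_zero_of_mul_eq_one h2) (right_ne_zero_of_mul_eq_one h3) h1
  obtain ⟨M, hM, hM', hM''⟩ := exists_intermediateField_trdeg_le (k := ℂ) (S : Set K)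
  have hfM (x : A) : f x ∈ M.toSubalgebra := by
    obtain ⟨p, rfl⟩ := hπ x
    exact eval_mem_of_Xmat_Ymat_mem ψ hψ M (hSM M hM hM') p
  obtain ⟨s, hs, hs'⟩ := exists_ringKrullDim_eq_trdeg_eq ℂ A
  have hle : Algebra.trdeg ℂ A ≤ Algebra.trdeg ℂ M :=
    trdeg_le_of_injective (f.codRestrict M.toSubalgebra hfM)
      ((AlgHom.injective_codRestrict f _ hfM).2 hinj)
  have : s ≤ S.card := by
    have := hle.trans hM''
    rw [hs'] at this
    simpa using this
  rw [hs]
  exact_mod_cast this.trans (by simpa using hS)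

theorem IntermediateField.mem_of_mulVec_eq_smul {k K ι : Type*} [Field k] [Field K] [Algebra k K]
    [Fintype ι] [DecidableEq ι] (M : IntermediateField k K)
    (hM : ∀ x : K, IsAlgebraic M x → x ∈ M) {A : Matrix ι ι K} (hA : ∀ i j, A i j ∈ M) {c : K}
    {v : ι → K} (hv : v ≠ 0) (h : A.mulVec v = c • v) : c ∈ M := by
  let A' : Matrix ι ι M := Matrix.of fun i j => ⟨A i j, hA i j⟩
  have hA' : A'.map (algebraMap M K) = A := rfl
  refine hM c ⟨A'.charpoly, A'.charpoly_monic.ne_zero, ?_⟩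
  rw [Polynomial.aeval_def, ← Polynomial.eval_map, ← Matrix.charpoly_map, hA',
    ← Matrix.charpoly_toLin']
  refine (Module.End.hasEigenvalue_iff_isRoot_charpoly _ _).1
    (Module.End.hasEigenvalue_of_hasEigenvector (x := v) ⟨Module.End.mem_eigenspace_iff.2 ?_, hv⟩)
  simpa using h

/-- The monomial matrix sending the basis vector indexed by `(i, k)` to `b k` times the one
indexed by `(i + 1, k)`. -/
def cyclicMatrix {K : Type*} [Zero K] {l m : ℕ} (b : Fin m → K) :
    Matrix (ZMod l × Fin m) (ZMod l × Fin m) K :=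
  Matrix.of fun p q => if p = (q.1 + 1, q.2) then b q.2 else 0

theorem mem_of_cyclic_eigenbasis {k K : Type*} [Field k] [Field K] [Algebra k K] {l m : ℕ}
    [NeZero l] (M : IntermediateField k K) (hM : ∀ x : K, IsAlgebraic M x → x ∈ M)
    {X Y g : Matrix (ZMod l × Fin m) (ZMod l × Fin m) K} (hX : ∀ p q, X p q ∈ M)
    (hY : ∀ p q, Y p q ∈ M) (hg : g.det ≠ 0) {d : ZMod l × Fin m → K}
    (hd : Function.Injective d) {b : Fin m → K} (hb : ∀ k, b k ≠ 0)
    (hXg : X * g = g * Matrix.diagonal d) (hYg : Y * g = g * cyclicMatrix b)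
    (r : ZMod l × Fin m) (hr : ∀ k, g r (0, k) ≠ 0) (hrM : ∀ k, g r (0, k) ∈ M) :
    (∀ p q, g p q ∈ M) ∧ (∀ q, d q ∈ M) ∧ ∀ k, b k ∈ M := by
  have hinj {v : ZMod l × Fin m → K} (hv : v ≠ 0) : g.mulVec v ≠ 0 :=
    fun h => hg (Matrix.exists_mulVec_eq_zero_iff.1 ⟨v, hv, h⟩)
  have hXcol (p q) : ∑ t, X p t * g t q = g p q * d q := by
    have := congrFun (congrFun hXg p) q
    rwa [Matrix.mul_diagonal, Matrix.mul_apply] at this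
  have hYcol (p q) : ∑ t, Y p t * g t q = g p (q.1 + 1, q.2) * b q.2 := by
    have := congrFun (congrFun hYg p) q
    rw [Matrix.mul_apply] at this
    rw [this, Matrix.mul_apply]
    simp [cyclicMatrix]
  have hdM (q) : d q ∈ M := by
    refine M.mem_of_mulVec_eq_smul hM hX (v := g.mulVec (Pi.single q 1))
      (hinj (by simp)) ?_
    ext p
    simpa [Matrix.mulVec, dotProduct, Pi.single_apply, mul_comm] using hXcol p q
  have hbM (k) : b k ∈ M := by
    refine M.mem_of_mulVec_eq_smul hM hY (v := g.mulVec fun q => if q.2 = k then 1 else 0)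
      (hinj fun h => by simpa using congrFun h (0, k)) ?_
    rw [Matrix.mulVec_mulVec, hYg, ← Matrix.mulVec_mulVec, ← Matrix.mulVec_smul]
    congr 1
    ext p
    have : ∀ q : ZMod l × Fin m, p = (q.1 + 1, q.2) ↔ q = (p.1 - 1, p.2) := by
      rintro ⟨i, j⟩
      obtain ⟨i', j'⟩ := p
      simp [eq_sub_iff_add_eq, eq_comm]
    simp only [Matrix.mulVec, dotProduct, cyclicMatrix, Matrix.of_apply, this, ite_mul, zero_mul,
      Finset.sum_ite_eq', Finset.mem_univ, if_true, Pi.smul_apply, smul_eq_mul]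
    split_ifs with h
    · rw [h]
    · simp
  have hzero (k p) : g p (0, k) ∈ M := by
    obtain ⟨φ, hφM, hφ⟩ := M.toSubfield.exists_linear_retraction
    let w : ZMod l × Fin m → K := fun p => φ (g p (0, k)) - g p (0, k)
    have hXw : X.mulVec w = d (0, k) • w := by
      ext p
      have h1 : ∑ t, X p t * φ (g t (0, k)) = d (0, k) * φ (g p (0, k)) := by
        have := congrArg φ (hXcol p (0, k))
        rw [map_sum, mul_comm] at this
        refine Eq.trans (Finset.sum_congr rfl fun t _ => ?_) (this.trans ?_)
        · exact (φ.map_smul ⟨X p t, hX p t⟩ _).symm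
        · exact φ.map_smul ⟨d (0, k), hdM _⟩ _
      simp only [Matrix.mulVec, dotProduct, w, mul_sub, Finset.sum_sub_distrib, h1, hXcol,
        Pi.smul_apply, smul_eq_mul]
      ring
    let u := g⁻¹.mulVec w
    have hu : g.mulVec u = w := by
      rw [Matrix.mulVec_mulVec, Matrix.mul_nonsing_inv _ hg.isUnit, Matrix.one_mulVec]
    have hdu : (Matrix.diagonal d).mulVec u = d (0, k) • u := by
      have h1 : g.mulVec ((Matrix.diagonal d).mulVec u - d (0, k) • u) = 0 := by
        rw [Matrix.mulVec_sub, Matrix.mulVec_mulVec, ← hXg, ← Matrix.mulVec_mulVec, hu,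
          Matrix.mulVec_smul, hu, hXw, sub_self]
      by_contra h
      exact hinj (sub_ne_zero.2 h) h1
    have hu0 (q) (hq : q ≠ (0, k)) : u q = 0 := by
      have := congrFun hdu q
      rw [Matrix.mulVec_diagonal, Pi.smul_apply, smul_eq_mul, ← sub_eq_zero, ← sub_mul] at this
      exact (mul_eq_zero.1 this).resolve_left (sub_ne_zero.2 (hd.ne hq))
    have hw (p) : w p = g p (0, k) * u (0, k) := by
      rw [← hu]
      exact Finset.sum_eq_single _ (fun q _ hq => by rw [hu0 q hq, mul_zero]) (by simp)
    have hur : u (0, k) = 0 := by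
      refine (mul_eq_zero.1 ((hw r).symm.trans ?_)).resolve_left (hr k)
      exact sub_eq_zero.2 (hφ _ (hrM k))
    have hwp : φ (g p (0, k)) - g p (0, k) = 0 := by
      rw [← mul_zero (g p (0, k)), ← hur]
      exact hw p
    exact sub_eq_zero.1 hwp ▸ hφM _
  have hcast (j : ℕ) (k p) : g p ((j : ZMod l), k) ∈ M := by
    induction j generalizing p with
    | zero => simpa using hzero k p
    | succ j ih =>
      have h1 := hYcol p ((j : ZMod l), k)
      rw [eq_comm, ← eq_div_iff (hb k)] at h1
      rw [Nat.cast_succ, h1]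
      exact div_mem (sum_mem fun t _ => mul_mem (hY p t) (ih t)) (hbM k)
  refine ⟨fun p q => ?_, hdM, hbM⟩
  have := hcast q.1.val q.2 p
  rwa [ZMod.natCast_zmod_val] at this

theorem exists_algHom_commFiber {n : ℕ} {a : ℂ} {K : Type*} [Field K] [Algebra ℂ K]
    {X Y : Matrix (Fin n) (Fin n) K} (hX : X.det ≠ 0) (hY : Y.det ≠ 0)
    (hXY : X * Y = algebraMap ℂ K a • (Y * X)) :
    ∃ ψ : MvPolynomial (CommFiberVar n) ℂ →ₐ[ℂ] K, (∀ p ∈ commFiberIdeal n a, ψ p = 0) ∧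
      (Xmat n).map ψ = X ∧ (Ymat n).map ψ = Y := by
  let ψ : MvPolynomial (CommFiberVar n) ℂ →ₐ[ℂ] K := MvPolynomial.aeval
    (Sum.elim (fun p => X p.1 p.2) (Sum.elim (fun p => Y p.1 p.2) ![X.det⁻¹, Y.det⁻¹]))
  have hψX : (Xmat n).map ψ = X := by
    ext i j
    simp [ψ, Xmat]
  have hψY : (Ymat n).map ψ = Y := by
    ext i j
    simp [ψ, Ymat]
  have hdet (A : Matrix (Fin n) (Fin n) (MvPolynomial (CommFiberVar n) ℂ)) :
      ψ A.det = (A.map ψ).det := AlgHom.map_det ψ A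
  have hmul (A B : Matrix (Fin n) (Fin n) (MvPolynomial (CommFiberVar n) ℂ)) (i j : Fin n) :
      ψ ((A * B) i j) = (A.map ψ * B.map ψ) i j := by
    simp [Matrix.mul_apply]
  refine ⟨ψ, fun p hp => ?_, hψX, hψY⟩
  have hle : commFiberIdeal n a ≤ RingHom.ker ψ := by
    refine Ideal.span_le.2 ?_
    rintro _ ((rfl | rfl) | ⟨i, j, rfl⟩)
    · change ψ _ = 0
      rw [map_sub, map_mul, hdet, hψX]
      simp [ψ, hX]
    · change ψ _ = 0
      rw [map_sub, map_mul, hdet, hψY]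
      simp [ψ, hY]
    · change ψ _ = 0
      rw [Matrix.sub_apply, Matrix.smul_apply, map_sub, map_smul, hmul, hmul, hψX, hψY, hXY,
        Matrix.smul_apply, algebraMap_smul, sub_self]
  exact hle hp

theorem diagonal_mul_cyclicMatrix {K : Type*} [CommRing K] {l m : ℕ} [NeZero l] {z : K}
    {d : ZMod l × Fin m → K} (hd : ∀ i k, d (i + 1, k) = z * d (i, k)) (b : Fin m → K) :
    Matrix.diagonal d * cyclicMatrix b = z • (cyclicMatrix b * Matrix.diagonal d) := by
  ext p q
  rw [Matrix.diagonal_mul, Matrix.smul_apply, Matrix.mul_diagonal, cyclicMatrix, Matrix.of_apply]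
  split_ifs with h
  · rw [h, hd, smul_eq_mul]
    ring
  · simp

theorem det_cyclicMatrix_ne_zero {K : Type*} [Field K] {l m : ℕ} [NeZero l] {b : Fin m → K}
    (hb : ∀ k, b k ≠ 0) : (cyclicMatrix (l := l) b).det ≠ 0 := by
  intro h
  obtain ⟨u, hu, h⟩ := Matrix.exists_mulVec_eq_zero_iff.2 h
  refine hu (funext fun q => ?_)
  have := congrFun h (q.1 + 1, q.2)
  have hq (x : ZMod l × Fin m) : (q.1 + 1, q.2) = (x.1 + 1, x.2) ↔ x = q := by
    simp [Prod.ext_iff, eq_comm]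
  simpa [Matrix.mulVec, dotProduct, cyclicMatrix, hq, hb] using this

theorem pow_val_add_one {K : Type*} [CommMonoid K] {l : ℕ} [NeZero l] {z : K} (hz : z ^ l = 1)
    (i : ZMod l) : z ^ (i + 1).val = z * z ^ i.val := by
  rw [← pow_succ', pow_eq_pow_mod _ hz, pow_eq_pow_mod (i.val + 1) hz]
  congr 1
  rw [ZMod.val_add, Nat.mod_mod, ZMod.val_one_eq_one_mod, Nat.add_mod_mod]

theorem le_ringKrullDim_commFiber {m l : ℕ} (hm : 1 ≤ m) (hl : 1 ≤ l) {ζ : ℂ}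
    (hζ : IsPrimitiveRoot ζ l) : ((l * m) ^ 2 + m : ℕ) ≤
      ringKrullDim (MvPolynomial (CommFiberVar (l * m)) ℂ ⧸ commFiberIdeal (l * m) ζ) := by
  have : NeZero l := ⟨by omega⟩
  let ι := ZMod l × Fin m
  let V := (ι × ι) ⊕ Fin m ⊕ Fin m
  let P := MvPolynomial V ℂ
  let K := FractionRing P
  have hinj : Function.Injective (algebraMap P K) := IsFractionRing.injective P K
  let v (t : V) : K := algebraMap P K (MvPolynomial.X t)
  have hv (t : V) : v t ≠ 0 := (map_ne_zero_iff _ hinj).2 (MvPolynomial.X_ne_zero t)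
  let g : Matrix ι ι K := Matrix.of fun p q => v (.inl (p, q))
  let b (k : Fin m) : K := v (.inr (.inr k))
  let d (p : ι) : K := v (.inr (.inl p.2)) * algebraMap ℂ K (ζ ^ p.1.val)
  have hζ0 : ζ ≠ 0 := hζ.ne_zero (by omega)
  have hg : g.det ≠ 0 := by
    let ρ : MvPolynomial (ι × ι) ℂ →+* K :=
      (algebraMap P K).comp (MvPolynomial.rename Sum.inl : _ →ₐ[ℂ] P)
    have hρ : Function.Injective ρ :=
      hinj.comp (MvPolynomial.rename_injective _ Sum.inl_injective)
    have h : g = ρ.mapMatrix (Matrix.mvPolynomialX ι ι ℂ) := by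
      ext p q
      simp [g, v, ρ]
    rw [h, ← RingHom.map_det]
    exact (map_ne_zero_iff _ hρ).2 (Matrix.det_mvPolynomialX_ne_zero ι ℂ)
  have hd : Function.Injective d := by
    rintro ⟨i, k⟩ ⟨j, k'⟩ h
    have h' : (MvPolynomial.X (.inr (.inl k)) * MvPolynomial.C (ζ ^ i.val) : P) =
        MvPolynomial.X (.inr (.inl k')) * MvPolynomial.C (ζ ^ j.val) := by
      apply hinj
      rw [map_mul, map_mul]
      exact h
    have h'' := congrArg (MvPolynomial.eval (Pi.single (.inr (.inl k)) 1)) h'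
    have hk : k' = k := by
      by_contra hk
      simp only [map_mul, MvPolynomial.eval_X, MvPolynomial.eval_C, Pi.single_eq_same,
        one_mul] at h''
      rw [Pi.single_eq_of_ne (fun e => hk (Sum.inl_injective (Sum.inr_injective e))),
        zero_mul] at h''
      exact pow_ne_zero _ hζ0 h''
    subst hk
    have hij : i.val = j.val := hζ.pow_inj i.val_lt j.val_lt (by simpa using h'')
    rw [ZMod.val_injective l hij]
  have hd0 (p) : d p ≠ 0 :=
    mul_ne_zero (hv _) ((map_ne_zero _).2 (pow_ne_zero _ hζ0))
  have hb (k) : b k ≠ 0 := hv _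
  have hcomm : Matrix.diagonal d * cyclicMatrix b =
      algebraMap ℂ K ζ • (cyclicMatrix b * Matrix.diagonal d) := by
    refine diagonal_mul_cyclicMatrix (fun i k => ?_) b
    simp only [d]
    rw [pow_val_add_one hζ.pow_eq_one, map_mul]
    ring
  have hgu := hg.isUnit
  have hconj (A B : Matrix ι ι K) : g * A * g⁻¹ * (g * B * g⁻¹) = g * (A * B) * g⁻¹ := by
    simp only [Matrix.mul_assoc, Matrix.nonsing_inv_mul_cancel_left _ _ hgu]
  have hconj' (A : Matrix ι ι K) : g * A * g⁻¹ * g = g * A :=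
    Matrix.nonsing_inv_mul_cancel_right _ _ hgu
  have hdetconj (A : Matrix ι ι K) (hA : A.det ≠ 0) : (g * A * g⁻¹).det ≠ 0 := by
    rw [Matrix.det_mul, Matrix.det_mul]
    exact mul_ne_zero (mul_ne_zero hg hA) (Matrix.isUnit_nonsing_inv_det _ hgu).ne_zero
  let X := g * Matrix.diagonal d * g⁻¹
  let Y := g * cyclicMatrix b * g⁻¹
  have hX : X.det ≠ 0 := hdetconj _ (by
    rw [Matrix.det_diagonal]
    exact Finset.prod_ne_zero_iff.2 fun p _ => hd0 p)
  have hY : Y.det ≠ 0 := hdetconj _ (det_cyclicMatrix_ne_zero hb)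
  have hXY : X * Y = algebraMap ℂ K ζ • (Y * X) := by
    simp only [X, Y]
    rw [hconj, hconj, hcomm, Matrix.mul_smul, Matrix.smul_mul]
  let σ : Fin (l * m) ≃ ι := Fintype.equivOfCardEq (by simp [ι, ZMod.card])
  obtain ⟨ψ, hψ, hψX, hψY⟩ := exists_algHom_commFiber (X := X.submatrix σ σ)
    (Y := Y.submatrix σ σ) (a := ζ) (by rwa [Matrix.det_submatrix_equiv_self])
    (by rwa [Matrix.det_submatrix_equiv_self]) (by
      rw [Matrix.submatrix_mul_equiv, Matrix.submatrix_mul_equiv, hXY]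
      rfl)
  refine le_ringKrullDim_quotient _ ψ hψ (m := m)
    (Set.range fun k : Fin m => g (0, ⟨0, hm⟩) (0, k)) ?_ fun M hψM hSM hM => ?_
  · exact Cardinal.mk_range_le.trans (by simp)
  have hXM (p q) : X p q ∈ M := by
    have := congrFun (congrFun hψX (σ.symm p)) (σ.symm q)
    simp only [Matrix.submatrix_apply, Equiv.apply_symm_apply] at this
    exact this ▸ hψM _
  have hYM (p q) : Y p q ∈ M := by
    have := congrFun (congrFun hψY (σ.symm p)) (σ.symm q)
    simp only [Matrix.submatrix_apply, Equiv.apply_symm_apply] at this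
    exact this ▸ hψM _
  obtain ⟨hgM, hdM, hbM⟩ := mem_of_cyclic_eigenbasis M hM hXM hYM hg hd hb (hconj' _) (hconj' _)
    (0, ⟨0, hm⟩) (fun k => hv _) (fun k => hSM ⟨k, rfl⟩)
  have hvM (t : V) : v t ∈ M := by
    match t with
    | .inl (p, q) => exact hgM p q
    | .inr (.inl k) => simpa [d] using hdM (0, k)
    | .inr (.inr k) => exact hbM k
  let f : P →ₐ[ℂ] K := IsScalarTower.toAlgHom ℂ P K
  have hfM (p : P) : f p ∈ M.toSubalgebra := by
    induction p using MvPolynomial.induction_on with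
    | C c => exact f.commutes c ▸ M.algebraMap_mem c
    | add p q hp hq => exact map_add f p q ▸ add_mem hp hq
    | mul_X p t hp => exact map_mul f p _ ▸ mul_mem hp (hvM t)
  have hle : Algebra.trdeg ℂ P ≤ Algebra.trdeg ℂ M :=
    trdeg_le_of_injective (f.codRestrict M.toSubalgebra hfM)
      ((AlgHom.injective_codRestrict f _ hfM).2 hinj)
  refine le_trans (le_of_eq ?_) hle
  rw [MvPolynomial.trdeg_of_isDomain, Cardinal.mk_fintype]
  simp [V, ι, ZMod.card]
  ring

/-- **Dimension of the commutator fiber over a central element of `SL_n(ℂ)`.**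
For `n = m·l` with `m, l ≥ 1` and `ξ` a primitive `n`-th root of unity, the coordinate
ring of the commutator fiber `{(X, Y) ∈ GL_n(ℂ)² : X·Y·X⁻¹·Y⁻¹ = ξ^m·I_n}` has Krull
dimension `n² + m`. -/
theorem commutator_fiber_krull_dim (m l : ℕ) (hm : 1 ≤ m) (hl : 1 ≤ l)
    (ξ : ℂ) (hξ : IsPrimitiveRoot ξ (l * m)) :
    ringKrullDim
        (MvPolynomial (CommFiberVar (l * m)) ℂ ⧸ commFiberIdeal (l * m) (ξ ^ m)) =
      ((l * m) ^ 2 + m : ℕ) := by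
  have hζ : IsPrimitiveRoot (ξ ^ m) l := hξ.pow (Nat.mul_pos hl hm) (mul_comm l m)
  exact le_antisymm (ringKrullDim_commFiber_le hl hζ) (le_ringKrullDim_commFiber hm hl hζ)
end
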